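/- arXiv:2002.03359 — 3 statements merged into one kernel-verified Lean document; each statement's English description precedes it below -/
import Mathlib

section
/- Let f : D → ℂ and g : D' → ℂ be univalent functions on domains D, D' ⊆ ℂ, both satisfying (H.1). Then the composite h := g ∘ f, defined on f^{-1}(D'), satisfies (H.1); in particular f^{-1}(D') contains some half-plane ℍ_{η''} and h(z) − z → 0 as z → ∞ with Im z > η''. If moreover f and g satisfy (H.2) with angular residues c_f and c_g respectively, then h satisfies (H.2) with angular residue c_f + c_g. -/
open Complex Set Filter Topology Bornology MeasureTheory Metric

noncomputable section

/-- The upper half-plane `ℍ = {z : ℂ | 0 < Im z}`. -/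
def UHP : Set ℂ := {z : ℂ | 0 < z.im}

/-- The half-plane `ℍ_η = {z : ℂ | η < Im z}`. -/
def HP (η : ℝ) : Set ℂ := {z : ℂ | η < z.im}

/-- The sector `△_θ = {z : ℂ | θ < arg z < π - θ}`. -/
def Sector (θ : ℝ) : Set ℂ :=
  {z : ℂ | θ < Complex.arg z ∧ Complex.arg z < Real.pi - θ}

/-- A closed horizontal line segment of positive length contained in `ℍ`. -/
def IsHorizontalSlit (C : Set ℂ) : Prop :=
  ∃ y xl xr : ℝ, 0 < y ∧ xl < xr ∧
    C = {z : ℂ | z.im = y ∧ z.re ∈ Set.Icc xl xr}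

/-- A parallel slit half-plane with `N` slits: `ℍ` minus `N` pairwise disjoint
closed horizontal segments of positive length. -/
def IsParallelSlitHalfPlaneN (N : ℕ) (D : Set ℂ) : Prop :=
  ∃ C : Fin N → Set ℂ,
    (∀ j, IsHorizontalSlit (C j)) ∧
    (Pairwise fun i j => Disjoint (C i) (C j)) ∧
    D = UHP \ ⋃ j, C j

/-- A parallel slit half-plane (with some number of slits). -/
def IsParallelSlitHalfPlane (D : Set ℂ) : Prop :=
  ∃ N : ℕ, IsParallelSlitHalfPlaneN N D

/-- (H.1): hydrodynamic normalization at infinity. -/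
def SatisfiesH1 (D : Set ℂ) (f : ℂ → ℂ) : Prop :=
  ∃ η : ℝ, 0 ≤ η ∧ HP η ⊆ D ∧
    Tendsto (fun z => f z - z) (cobounded ℂ ⊓ 𝓟 (HP η)) (𝓝 0)

/-- (H.2): `f` has angular residue `c` at infinity, i.e. `z (f z - z) → -c`
as `z → ∞` within every sector `△_θ`. -/
def SatisfiesH2 (f : ℂ → ℂ) (c : ℂ) : Prop :=
  ∀ θ : ℝ, 0 < θ → θ < Real.pi / 2 →
    Tendsto (fun z => z * (f z - z)) (cobounded ℂ ⊓ 𝓟 (Sector θ)) (𝓝 (-c))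

/-- `F` is an ℍ-hull: relatively closed in `ℍ` with `ℍ \ F` a simply connected
domain. -/
def IsHHull (F : Set ℂ) : Prop :=
  F ⊆ UHP ∧ closure F ∩ UHP ⊆ F ∧
    IsConnected (UHP \ F) ∧ SimplyConnectedSpace ↥(UHP \ F)

/-- `η_D = min {Im w | w ∈ ℍ \ D}`. -/
def etaD (D : Set ℂ) : ℝ := sInf (Complex.im '' (UHP \ D))

/-- A (chordal) evolution family `φ t s : D s → D t` (for `s ≤ t` in `I`) over
parallel slit half-planes `D t`, where `lam t` is the angular residue of
`φ t 0` at infinity. -/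
structure IsEvolutionFamily (I : Set ℝ) (D : ℝ → Set ℂ)
    (φ : ℝ → ℝ → ℂ → ℂ) (lam : ℝ → ℂ) : Prop where
  slit : ∀ t ∈ I, IsParallelSlitHalfPlane (D t)
  mapsTo : ∀ s ∈ I, ∀ t ∈ I, s ≤ t → Set.MapsTo (φ t s) (D s) (D t)
  holo : ∀ s ∈ I, ∀ t ∈ I, s ≤ t → DifferentiableOn ℂ (φ t s) (D s)
  inj : ∀ s ∈ I, ∀ t ∈ I, s ≤ t → Set.InjOn (φ t s) (D s)
  h1 : ∀ s ∈ I, ∀ t ∈ I, s ≤ t → SatisfiesH1 (D s) (φ t s)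
  h2 : ∀ s ∈ I, ∀ t ∈ I, s ≤ t → ∃ c : ℂ, SatisfiesH2 (φ t s) c
  h3 : ∀ s ∈ I, ∀ t ∈ I, s ≤ t → IsHHull (D t \ φ t s '' D s)
  ef1 : ∀ t ∈ I, Set.EqOn (φ t t) id (D t)
  ef2 : ∀ s ∈ I, ∀ t ∈ I, ∀ u ∈ I, s ≤ t → t ≤ u →
    ∀ z ∈ D s, φ u s z = φ u t (φ t s z)
  lam_res : ∀ t ∈ I, SatisfiesH2 (φ t 0) (lam t)
  ef3 : ContinuousOn lam I

/-- A (chordal) Loewner chain `f t : D t → Dcod` over parallel slit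
half-planes `D t` with codomain `Dcod`, where `ell t` is the angular residue
of `f t` at infinity. -/
structure IsLoewnerChain (I : Set ℝ) (D : ℝ → Set ℂ) (Dcod : Set ℂ)
    (f : ℝ → ℂ → ℂ) (ell : ℝ → ℂ) : Prop where
  slit : ∀ t ∈ I, IsParallelSlitHalfPlane (D t)
  slitcod : IsParallelSlitHalfPlane Dcod
  mapsTo : ∀ t ∈ I, Set.MapsTo (f t) (D t) Dcod
  holo : ∀ t ∈ I, DifferentiableOn ℂ (f t) (D t)
  inj : ∀ t ∈ I, Set.InjOn (f t) (D t)
  h1 : ∀ t ∈ I, SatisfiesH1 (D t) (f t)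
  h2 : ∀ t ∈ I, SatisfiesH2 (f t) (ell t)
  h3 : ∀ t ∈ I, IsHHull (Dcod \ f t '' D t)
  lc1 : ∀ s ∈ I, ∀ t ∈ I, s ≤ t → f s '' D s ⊆ f t '' D t
  lc2 : ContinuousOn ell I

/-- `(Lip)_μ`: Lipschitz continuity of `t ↦ f t` w.r.t. the measure `μ`,
uniformly on compact subsets of `D`. -/
def SatisfiesLip (I : Set ℝ) (μ : Measure ℝ) (D : Set ℂ)
    (f : ℝ → ℂ → ℂ) : Prop :=
  ∀ K : Set ℂ, K ⊆ D → IsCompact K → ∃ L : ℝ,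
    ∀ s ∈ I, ∀ t ∈ I, s ≤ t → ∀ z ∈ K,
      ‖f t z - f s z‖ ≤ L * (μ (Set.Ioc s t)).toReal

/-- `(AC)_μ`: absolute continuity of `t ↦ f t` w.r.t. the measure `μ`,
uniformly on compact subsets of `D`. -/
def SatisfiesAC (I : Set ℝ) (μ : Measure ℝ) (D : Set ℂ)
    (f : ℝ → ℂ → ℂ) : Prop :=
  ∀ K : Set ℂ, K ⊆ D → IsCompact K →
    ∃ ν : Measure ℝ, ν ≪ μ ∧
      (∀ a ∈ I, ∀ b ∈ I, ν (Set.Icc a b) < ⊤) ∧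
      ∀ s ∈ I, ∀ t ∈ I, s ≤ t → ∀ z ∈ K,
        ‖f t z - f s z‖ ≤ (ν (Set.Ioc s t)).toReal

/-- The symmetric difference quotient
`(f (t+δ) z - f (t-δ) z) / μ((t-δ, t+δ))`. -/
def symmQuot (μ : Measure ℝ) (f : ℝ → ℂ → ℂ) (t δ : ℝ) (z : ℂ) : ℂ :=
  (f (t + δ) z - f (t - δ) z) / ((μ (Set.Ioo (t - δ) (t + δ))).toReal : ℂ)

/-- A cross-cut of a domain `G`. -/
def IsCrossCut (G C : Set ℂ) : Prop :=
  ∃ c : ℝ → ℂ, ContinuousOn c (Set.Icc 0 1) ∧ Set.InjOn c (Set.Icc 0 1) ∧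
    c 0 ∈ frontier G ∧ c 1 ∈ frontier G ∧ c '' Set.Ioo 0 1 ⊆ G ∧
    C = c '' Set.Icc 0 1

/-- `C` separates `S` from `∞` in `G`: `S` is disjoint from the unbounded
connected component of `G \ C`. -/
def SeparatesFromInfty (G C S : Set ℂ) : Prop :=
  ∀ z ∈ S ∩ (G \ C), Bornology.IsBounded (connectedComponentIn (G \ C) z)

/-- The local growth property of a family of hulls `(F t)_{t ∈ [0,T]}` in `D`. -/
def LocalGrowth (T : ℝ) (D : Set ℂ) (F : ℝ → Set ℂ) : Prop :=
  ∀ ε : ℝ, 0 < ε → ∃ δ ∈ Set.Ioo 0 T, ∀ t ∈ Set.Icc 0 (T - δ),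
    ∃ C : Set ℂ, IsCrossCut (D \ F t) C ∧ Metric.diam C < ε ∧
      SeparatesFromInfty (D \ F t) C (F (t + δ) \ F t)

/-- Carathéodory kernel of a sequence of domains w.r.t. the point `a`. -/
def kernelAt (a : ℂ) (G : ℕ → Set ℂ) : Set ℂ :=
  connectedComponentIn
    {z : ℂ | ∃ r > 0, ∃ N : ℕ, ∀ n ≥ N, Metric.ball z r ⊆ G n} a

/-- Left continuity in Carathéodory's sense of `(F t)` at `t₀`. -/
def CaratheodoryLeftContinuousAt (D : Set ℂ) (F : ℝ → Set ℂ)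
    (T t₀ : ℝ) : Prop :=
  ∀ a ∈ D \ F T, ∀ s : ℕ → ℝ,
    Monotone s → (∀ n, s n ∈ Set.Ico 0 t₀) → Tendsto s atTop (𝓝 t₀) →
      kernelAt a (fun n => D \ F (s n)) = D \ F t₀

/-- A map asymptotic to the identity along a filter tending to infinity tends to infinity. -/
theorem tendsto_cobounded_of_sub_tendsto_zero {l : Filter ℂ} {f : ℂ → ℂ}
    (hl : l ≤ cobounded ℂ) (hf : Tendsto (fun z => f z - z) l (𝓝 0)) :
    Tendsto f l (cobounded ℂ) := by
  rw [← tendsto_norm_atTop_iff_cobounded]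
  have hz : Tendsto (fun z : ℂ => ‖z‖) l atTop := tendsto_norm_cobounded_atTop.mono_left hl
  refine tendsto_atTop_mono (fun z => ?_) (hz.atTop_add hf.norm.neg)
  have := norm_sub_norm_le z (f z)
  rw [norm_sub_rev] at this
  linarith

/-- A high enough half-plane avoids every bounded set. -/
theorem exists_HP_forall_of_eventually {η : ℝ} {p : ℂ → Prop}
    (h : ∀ᶠ z in cobounded ℂ ⊓ 𝓟 (HP η), p z) : ∃ M : ℝ, ∀ z ∈ HP M, p z := by
  rw [eventually_inf_principal, ← comap_norm_atTop, eventually_comap] at h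
  obtain ⟨R, hR⟩ := eventually_atTop.1 h
  refine ⟨max R η, fun z hz => ?_⟩
  obtain ⟨h₁, h₂⟩ := max_lt_iff.1 (show max R η < z.im from hz)
  exact hR ‖z‖ (h₁.le.trans ((le_abs_self _).trans (Complex.abs_im_le_norm z))) z rfl h₂

theorem HP_anti {a b : ℝ} (h : a ≤ b) : HP b ⊆ HP a := fun _ hz => lt_of_le_of_lt h hz

theorem SatisfiesH1.comp {D D' : Set ℂ} {f g : ℂ → ℂ}
    (hf : SatisfiesH1 D f) (hg : SatisfiesH1 D' g) :
    SatisfiesH1 (D ∩ f ⁻¹' D') (g ∘ f) := by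
  obtain ⟨η, hη, hD, hf⟩ := hf
  obtain ⟨η', -, hD', hg⟩ := hg
  obtain ⟨M, hM⟩ := exists_HP_forall_of_eventually (hf.norm.eventually_lt_const (by simp :
    ‖(0 : ℂ)‖ < 1))
  set μ := max η (max M (η' + 1))
  have hηle : HP μ ⊆ HP η := HP_anti (le_max_left _ _)
  have hmaps : ∀ z ∈ HP μ, f z ∈ HP η' := by
    intro z hz
    have h₁ := hM z (HP_anti ((le_max_left _ _).trans (le_max_right _ _)) hz)
    have h₂ : η' + 1 < z.im := HP_anti ((le_max_right M _).trans (le_max_right η _)) hz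
    have h₃ := (abs_lt.1 ((Complex.abs_im_le_norm (f z - z)).trans_lt h₁)).1
    rw [Complex.sub_im] at h₃
    change η' < (f z).im
    linarith
  refine ⟨μ, hη.trans (le_max_left _ _), fun z hz => ⟨hD (hηle hz), hD' (hmaps z hz)⟩, ?_⟩
  have hf' : Tendsto (fun z => f z - z) (cobounded ℂ ⊓ 𝓟 (HP μ)) (𝓝 0) :=
    hf.mono_left (inf_le_inf_left _ (principal_mono.2 hηle))
  have hlim : Tendsto f (cobounded ℂ ⊓ 𝓟 (HP μ)) (cobounded ℂ ⊓ 𝓟 (HP η')) :=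
    tendsto_inf.2 ⟨tendsto_cobounded_of_sub_tendsto_zero inf_le_left hf',
      tendsto_principal.2 (eventually_inf_principal.2 (Eventually.of_forall hmaps))⟩
  simpa using (hg.comp hlim).add hf'

/-- Multiplication by a factor tending to `1` eventually moves a sector into any wider one. -/
theorem eventually_mul_mem_sector {l : Filter ℂ} {u : ℂ → ℂ} {θ θ' : ℝ} (hθ' : 0 < θ')
    (hθ : θ' < θ) (hl : ∀ᶠ z in l, z ∈ Sector θ) (hu : Tendsto u l (𝓝 1)) :
    ∀ᶠ z in l, z * u z ∈ Sector θ' := by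
  have harg : Tendsto (fun z => Complex.arg (u z)) l (𝓝 0) := by
    simpa [Function.comp_def] using (Complex.continuousAt_arg (x := 1) (by simp)).tendsto.comp hu
  filter_upwards [hl, hu.eventually_ne one_ne_zero,
    harg.eventually (Ioo_mem_nhds (by linarith : -(θ - θ') < 0) (by linarith : 0 < θ - θ'))]
    with z hz hne ha
  obtain ⟨h₁, h₂⟩ := hz
  obtain ⟨h₃, h₄⟩ := ha
  have hz0 : z ≠ 0 := by
    rintro rfl
    rw [Complex.arg_zero] at h₁
    linarith
  have hpi := Real.pi_pos
  have key := Complex.arg_mul hz0 hne ⟨by linarith, by linarith⟩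
  exact ⟨by rw [key]; linarith, by rw [key]; linarith⟩

theorem SatisfiesH2.comp {f g : ℂ → ℂ} {cf cg : ℂ}
    (hf : SatisfiesH2 f cf) (hg : SatisfiesH2 g cg) : SatisfiesH2 (g ∘ f) (cf + cg) := by
  intro θ hθ hθ'
  have hF := hf θ hθ hθ'
  set l := cobounded ℂ ⊓ 𝓟 (Sector θ)
  have hcob : l ≤ cobounded ℂ := inf_le_left
  have hinv : Tendsto (fun z : ℂ => z⁻¹) l (𝓝 0) := tendsto_inv₀_cobounded.mono_left hcob
  have hne : ∀ᶠ z in l, z ≠ 0 := hcob (eventually_ne_cobounded 0)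
  have hsub : Tendsto (fun z => f z - z) l (𝓝 0) := by
    have := hinv.mul hF
    rw [zero_mul] at this
    refine this.congr' ?_
    filter_upwards [hne] with z hz
    field_simp
  have hfcob := tendsto_cobounded_of_sub_tendsto_zero hcob hsub
  have hquot : Tendsto (fun z => f z / z) l (𝓝 1) := by
    have := (hinv.mul hsub).const_add 1
    rw [zero_mul, add_zero] at this
    refine this.congr' ?_
    filter_upwards [hne] with z hz
    field_simp
    ring
  have hsec : ∀ᶠ z in l, f z ∈ Sector (θ / 2) := by
    have hmem : ∀ᶠ z in l, z ∈ Sector θ := mem_inf_of_right (mem_principal_self _)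
    filter_upwards [hne, eventually_mul_mem_sector (half_pos hθ) (half_lt_self hθ) hmem hquot]
      with z hz h
    rwa [mul_div_cancel₀ _ hz] at h
  have hG := (hg (θ / 2) (half_pos hθ) ((half_lt_self hθ).trans hθ')).comp
    (tendsto_inf.2 ⟨hfcob, tendsto_principal.2 hsec⟩)
  have hsum := hF.add ((hquot.inv₀ one_ne_zero).mul hG)
  have hc : -cf + 1⁻¹ * -cg = -(cf + cg) := by ring
  rw [hc] at hsum
  refine hsum.congr' ?_
  filter_upwards [hne, hfcob (eventually_ne_cobounded 0)] with z hz hfz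
  simp only [Function.comp_apply]
  have hfz' : f z ≠ 0 := hfz
  field_simp
  ring

/-- the composite of univalent functions with (H.1) satisfies
(H.1), and its angular residue is the sum of the residues. -/
theorem statement10 {D D' : Set ℂ} (hD : IsOpen D) (hD' : IsOpen D')
    {f g : ℂ → ℂ}
    (hfd : DifferentiableOn ℂ f D) (hfi : Set.InjOn f D)
    (hgd : DifferentiableOn ℂ g D') (hgi : Set.InjOn g D')
    (h1f : SatisfiesH1 D f) (h1g : SatisfiesH1 D' g) :
    SatisfiesH1 (D ∩ f ⁻¹' D') (g ∘ f) ∧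
    ∀ cf cg : ℂ, SatisfiesH2 f cf → SatisfiesH2 g cg →
      SatisfiesH2 (g ∘ f) (cf + cg) := by
  exact ⟨h1f.comp h1g, fun _ _ hf hg => hf.comp hg⟩
end
end

section
/- Let D ⊆ ℂ be open, let f be holomorphic and injective on D, let z₀ ∈ ℂ and r > 0 satisfy closedBall(z₀, r) ⊆ D, and let a ∈ ball(z₀, r) with w := f(a). Then a = (1/(2πi)) ∮_{|ζ−z₀|=r} ζ·f'(ζ)/(f(ζ) − w) dζ, where the integral is the contour integral over the circle of radius r centered at z₀ (Lagrange inversion formula; note that injectivity of f guarantees f(ζ) ≠ w on this circle). -/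
open Complex Set Filter Topology Bornology MeasureTheory Metric

noncomputable section

/-- An injective holomorphic function on an open set is nowhere eventually constant. -/
lemma not_eventually_eq_of_injOn {D : Set ℂ} (hD : IsOpen D) {f : ℂ → ℂ}
    (hinj : Set.InjOn f D) {z : ℂ} (hz : z ∈ D) : ¬ ∀ᶠ x in 𝓝 z, f x = f z := by
  intro h
  have h1 : ∀ᶠ x in 𝓝[≠] z, x = z := by
    refine Filter.Eventually.filter_mono nhdsWithin_le_nhds ?_
    filter_upwards [h, hD.mem_nhds hz] with x hx hxD using hinj hxD hz hx
  obtain ⟨x, hx, hne⟩ := (h1.and self_mem_nhdsWithin).exists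
  exact hne hx

/-- The derivative of an injective holomorphic function on an open set has no zeros. -/
lemma deriv_ne_zero_of_injOn {D : Set ℂ} (hD : IsOpen D) {f : ℂ → ℂ}
    (hf : DifferentiableOn ℂ f D) (hinj : Set.InjOn f D) {a : ℂ} (ha : a ∈ D) :
    deriv f a ≠ 0 := by
  set g := Function.invFunOn f D
  have hgf : ∀ z ∈ D, g (f z) = z := hinj.leftInvOn_invFunOn
  have hopen : ∀ z ∈ D, 𝓝 (f z) ≤ map f (𝓝 z) := fun z hz =>
    ((hf.analyticAt (hD.mem_nhds hz)).eventually_constant_or_nhds_le_map_nhds).resolve_left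
      (not_eventually_eq_of_injOn hD hinj hz)
  have hgf' : ∀ z ∈ D, g ∘ f =ᶠ[𝓝 z] id := fun z hz => by
    filter_upwards [hD.mem_nhds hz] with x hx using hgf x hx
  have hgc : ∀ z ∈ D, ContinuousAt g (f z) := fun z hz => by
    rw [ContinuousAt, hgf z hz]
    calc map g (𝓝 (f z)) ≤ map g (map f (𝓝 z)) := map_mono (hopen z hz)
      _ = 𝓝 z := by rw [map_map, map_congr (hgf' z hz), map_id]
  have hfg : ∀ z ∈ D, ∀ᶠ y in 𝓝 (f z), f (g y) = y := fun z hz => by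
    refine hopen z hz (mem_map.2 ?_)
    filter_upwards [hD.mem_nhds hz] with x hx
    simp [hgf x hx]
  have hne : ∀ᶠ z in 𝓝[≠] a, deriv f z ≠ 0 := by
    refine ((hf.analyticAt (hD.mem_nhds ha)).deriv.eventually_eq_zero_or_eventually_ne_zero).resolve_left
      fun h => not_eventually_eq_of_injOn hD hinj ha ?_
    obtain ⟨ε, hε, hball⟩ := Metric.mem_nhds_iff.1 (inter_mem h (hD.mem_nhds ha))
    filter_upwards [Metric.ball_mem_nhds a hε] with x hx
    exact Metric.isOpen_ball.is_const_of_deriv_eq_zero (convex_ball a ε).isPreconnected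
      (hf.mono fun y hy => (hball hy).2) (fun y hy => (hball hy).1) hx
      (Metric.mem_ball_self hε)
  have hgd : ∀ᶠ y in 𝓝[≠] (f a), DifferentiableAt ℂ g y := by
    rw [eventually_nhdsWithin_iff] at hne ⊢
    refine hopen a ha (mem_map.2 ?_)
    filter_upwards [hne, hD.mem_nhds ha] with z hz hzD hfz
    have hza : z ≠ a := fun h => hfz (by simp [h])
    refine (HasDerivAt.of_local_left_inverse (hgc z hzD) (f' := deriv f z) ?_ (hz hza)
      (hfg z hzD)).differentiableAt
    rw [hgf z hzD]
    exact (hf.differentiableAt (hD.mem_nhds hzD)).hasDerivAt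
  have hga : DifferentiableAt ℂ g (f a) :=
    (analyticAt_of_differentiable_on_punctured_nhds_of_continuousAt hgd (hgc a ha)).differentiableAt
  have hcomp := hga.hasDerivAt.comp a (hf.differentiableAt (hD.mem_nhds ha)).hasDerivAt
  have hmul := hcomp.unique ((hasDerivAt_id a).congr_of_eventuallyEq (hgf' a ha))
  intro h0
  simp [h0] at hmul

/-- Lagrange inversion formula. -/
theorem statement14 {D : Set ℂ} (hD : IsOpen D)
    {f : ℂ → ℂ} (hf : DifferentiableOn ℂ f D) (hinj : Set.InjOn f D)
    {z₀ : ℂ} {r : ℝ} (hr : 0 < r) (hball : Metric.closedBall z₀ r ⊆ D)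
    {a : ℂ} (ha : a ∈ Metric.ball z₀ r) :
    a = (1 / (2 * (Real.pi : ℂ) * Complex.I)) *
      (∮ ζ in C(z₀, r), ζ * deriv f ζ / (f ζ - f a)) := by
  have haD : a ∈ D := hball (Metric.ball_subset_closedBall ha)
  have hfa : deriv f a ≠ 0 := deriv_ne_zero_of_injOn hD hf hinj haD
  have hslope : ∀ ζ ∈ D, dslope f a ζ ≠ 0 := by
    intro ζ hζ
    rcases eq_or_ne ζ a with rfl | hne
    · rwa [dslope_same]
    · rw [dslope_of_ne _ hne, slope_def_field]
      exact div_ne_zero (sub_ne_zero.2 fun h => hne (hinj hζ haD h)) (sub_ne_zero.2 hne)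
  have hdiff : DifferentiableOn ℂ (fun ζ => ζ * deriv f ζ / dslope f a ζ) D :=
    (differentiableOn_id.mul (hf.deriv hD)).div
      ((Complex.differentiableOn_dslope (hD.mem_nhds haD)).2 hf) hslope
  have hcauchy := (hdiff.mono hball).circleIntegral_sub_inv_smul ha
  have hcongr : (∮ ζ in C(z₀, r), ζ * deriv f ζ / (f ζ - f a)) =
      ∮ ζ in C(z₀, r), (ζ - a)⁻¹ • (ζ * deriv f ζ / dslope f a ζ) := by
    refine circleIntegral.integral_congr hr.le fun ζ _ => ?_
    simp only [smul_eq_mul]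
    rw [← sub_smul_dslope f a ζ, smul_eq_mul]
    simp only [div_eq_mul_inv, mul_inv]
    ring
  rw [hcongr, hcauchy, dslope_same, mul_div_assoc, div_self hfa, smul_eq_mul, mul_one, ← mul_assoc,
    one_div, inv_mul_cancel₀ Complex.two_pi_I_ne_zero, one_mul]
end
end

section
/- Let D be a parallel slit half-plane and (F_t)_{t∈[0,T]} a strictly increasing family of bounded ℍ-hulls contained in D whose closures are disjoint from the slits of D, with mapping-out functions g_t : D ∖ F_t → D_t and half-plane capacities ℓ(t) as in the context. If (F_t)_{t∈[0,T]} has the local growth property, then the function t ↦ ℓ(t) is continuous on [0,T]. -/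
open Complex Set Filter Topology Bornology MeasureTheory Metric

noncomputable section

/-- A branch of `log (z - p)` on a simply connected open set omitting `p`. -/
lemma exists_primitive_inv_sub {U : Set ℂ} (hUo : IsOpen U) (hUc : IsSimplyConnected U) {p : ℂ}
    (hp : p ∉ U) : ∃ L : ℂ → ℂ, ∀ z ∈ U, HasDerivAt L ((z - p)⁻¹) z := by
  obtain ⟨L, hLc, hL⟩ := Complex.exists_continuousOn_eqOn_exp_comp hUc hUo
    (g := fun z => z - p) (by fun_prop) (by
      rintro ⟨z, hz, h⟩
      exact hp (by rwa [← sub_eq_zero.1 h]))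
  refine ⟨L, fun z hz => ?_⟩
  have hLz : exp (L z) = z - p := hL hz
  have h1 : HasDerivAt (fun u => exp u + p) (z - p) (L z) := by
    simpa [hLz] using (Complex.hasDerivAt_exp (L z)).add_const p
  refine HasDerivAt.of_local_left_inverse (hLc.continuousAt (hUo.mem_nhds hz)) h1 ?_ ?_
  · intro h
    exact hp (by rwa [← sub_eq_zero.1 h])
  · filter_upwards [hUo.mem_nhds hz] with y hy
    have : exp (L y) = y - p := hL hy
    simp [this]

lemma isCompact_of_eventually_notMem {U S : Set ℂ} (hSU : S ⊆ U) (hcl : closure S ∩ U ⊆ S)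
    (hb : Bornology.IsBounded S)
    (hf : ∀ p ∈ closure U, p ∉ U → ∀ᶠ z in 𝓝[U] p, z ∉ S) : IsCompact S := by
  refine Metric.isCompact_of_isClosed_isBounded ?_ hb
  refine isClosed_of_closure_subset fun p hp => ?_
  by_cases hpU : p ∈ U
  · exact hcl ⟨hp, hpU⟩
  · exfalso
    have h1 := hf p (closure_mono hSU hp) hpU
    rw [eventually_nhdsWithin_iff] at h1
    obtain ⟨z, h2, h3⟩ := (h1.and_frequently (mem_closure_iff_frequently.1 hp)).exists
    exact h2 (hSU h3) h3

lemma isOpen_image_of_not_eventually_const {U : Set ℂ} {f : ℂ → ℂ} (hU : IsOpen U)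
    (hf : DifferentiableOn ℂ f U) (hnc : ∀ z ∈ U, ¬ ∀ᶠ w in 𝓝 z, f w = f z) :
    IsOpen (f '' U) := by
  rw [isOpen_iff_mem_nhds]
  rintro _ ⟨z, hz, rfl⟩
  rcases (hf.analyticAt (hU.mem_nhds hz)).eventually_constant_or_nhds_le_map_nhds with h | h
  · exact absurd h (hnc z hz)
  · exact h (image_mem_map (hU.mem_nhds hz))

lemma not_eventually_const_of_injOn {U : Set ℂ} {f : ℂ → ℂ} (hU : IsOpen U)
    (hf : InjOn f U) : ∀ z ∈ U, ¬ ∀ᶠ w in 𝓝 z, f w = f z := by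
  intro z hz h
  have h2 : ∀ᶠ w in 𝓝[≠] z, w = z := by
    filter_upwards [h.filter_mono nhdsWithin_le_nhds,
      (show ∀ᶠ w in 𝓝 z, w ∈ U from hU.mem_nhds hz).filter_mono nhdsWithin_le_nhds] with w h1 h2
    exact hf h2 hz h1
  obtain ⟨w, h3, h4⟩ := (h2.and self_mem_nhdsWithin).exists
  exact h4 h3

/-- If, for all but finitely many heights `y > ω`, the function attains the height `y` only on a
compact set, then it stays below the height `ω`: a horizontal line has no nonempty compact open
subset. -/
lemma im_le_of_isCompact_level {U : Set ℂ} {f : ℂ → ℂ} (hU : IsOpen U)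
    (hf : DifferentiableOn ℂ f U) (hnc : ∀ z ∈ U, ¬ ∀ᶠ w in 𝓝 z, f w = f z)
    {A : Set ℝ} (hA : A.Finite) {ω : ℝ}
    (hK : ∀ y > ω, y ∉ A → IsCompact {z ∈ U | (f z).im = y}) :
    ∀ z ∈ U, (f z).im ≤ ω := by
  intro z hz
  by_contra! hlt
  have hop := isOpen_image_of_not_eventually_const hU hf hnc
  obtain ⟨y, ⟨hy1, hy2⟩, hyA⟩ : ∃ y, (ω < y ∧ (⟨(f z).re, y⟩ : ℂ) ∈ f '' U) ∧ y ∉ A := by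
    have hc : Continuous fun y : ℝ => (⟨(f z).re, y⟩ : ℂ) := by
      have : (fun y : ℝ => (⟨(f z).re, y⟩ : ℂ)) = fun y : ℝ => ((f z).re : ℂ) + y * I := by
        funext y; exact Complex.mk_eq_add_mul_I _ _
      rw [this]; fun_prop
    have h1 : {y : ℝ | ω < y ∧ (⟨(f z).re, y⟩ : ℂ) ∈ f '' U} ∈ 𝓝 (f z).im := by
      refine Filter.inter_mem (lt_mem_nhds hlt) ?_
      refine (hop.preimage hc).mem_nhds ?_
      exact ⟨z, hz, rfl⟩
    have h2 := infinite_of_mem_nhds _ h1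
    obtain ⟨y, h3, h4⟩ := (h2.sdiff hA).nonempty
    exact ⟨y, h3, h4⟩
  have hc : Continuous fun x : ℝ => (⟨x, y⟩ : ℂ) := by
    have : (fun x : ℝ => (⟨x, y⟩ : ℂ)) = fun x : ℝ => (x : ℂ) + y * I := by
      funext x; exact Complex.mk_eq_add_mul_I _ _
    rw [this]; fun_prop
  set S : Set ℝ := (fun x : ℝ => (⟨x, y⟩ : ℂ)) ⁻¹' (f '' U) with hS
  have hSo : IsOpen S := hop.preimage hc
  have hSK : S = (fun z => (f z).re) '' {z ∈ U | (f z).im = y} := by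
    ext x
    constructor
    · rintro ⟨z, hz, h⟩
      exact ⟨z, ⟨hz, by rw [h]⟩, by simp [h]⟩
    · rintro ⟨z, ⟨hz, h⟩, rfl⟩
      exact ⟨z, hz, Complex.ext rfl h⟩
  have hScomp : IsCompact S := by
    rw [hSK]
    refine (hK y hy1 hyA).image_of_continuousOn ?_
    exact Complex.continuous_re.comp_continuousOn (hf.continuousOn.mono (sep_subset _ _))
  have := IsClopen.eq_univ ⟨hScomp.isClosed, hSo⟩ ⟨_, hy2⟩
  exact noncompact_univ ℝ (this ▸ hScomp)

lemma im_nonpos_of_isCompact_superlevel {U : Set ℂ} {f : ℂ → ℂ} (hU : IsOpen U)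
    (hf : DifferentiableOn ℂ f U)
    (hK : ∀ ε > 0, IsCompact {z ∈ U | ε ≤ (f z).im}) :
    ∀ z ∈ U, (f z).im ≤ 0 := by
  intro z hz
  by_contra! hlt
  have hcont : ContinuousOn (fun z => (f z).im) U :=
    Complex.continuous_im.comp_continuousOn hf.continuousOn
  obtain ⟨z1, ⟨hz1U, hz1⟩, hmax⟩ := (hK _ hlt).exists_isMaxOn ⟨z, hz, le_refl _⟩
    (hcont.mono (sep_subset _ _))
  have hmax' : ∀ w ∈ U, (f w).im ≤ (f z1).im := by
    intro w hw
    by_cases h : (f z).im ≤ (f w).im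
    · exact hmax ⟨hw, h⟩
    · linarith
  set S := {w ∈ U | (f z1).im ≤ (f w).im}
  have hSc : IsCompact S := hK _ (by linarith)
  have hSo : IsOpen S := by
    rw [isOpen_iff_mem_nhds]
    rintro w ⟨hw, hle⟩
    have hd : ∀ᶠ v in 𝓝 w, DifferentiableAt ℂ (fun v => exp (-I * f v)) v := by
      filter_upwards [hU.mem_nhds hw] with v hv
      exact ((hf.differentiableAt (hU.mem_nhds hv)).const_mul _).cexp
    have hl : IsLocalMax (norm ∘ fun v => exp (-I * f v)) w := by
      filter_upwards [hU.mem_nhds hw] with v hv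
      simp only [Function.comp, Complex.norm_exp]
      refine Real.exp_le_exp.2 ?_
      simpa using (hmax' v hv).trans hle
    filter_upwards [Complex.eventually_eq_of_isLocalMax_norm hd hl, hU.mem_nhds hw] with v hv hvU
    refine ⟨hvU, hle.trans ?_⟩
    have h3 := congrArg norm hv
    simp only [Complex.norm_exp] at h3
    have h4 := Real.exp_injective h3
    simp at h4
    exact h4.ge
  have := IsClopen.eq_univ ⟨hSc.isClosed, hSo⟩ ⟨z1, hz1U, le_refl _⟩
  exact noncompact_univ ℂ (this ▸ hSc)

lemma isOpen_UHP : IsOpen UHP := isOpen_lt continuous_const Complex.continuous_im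

lemma IsHorizontalSlit.subset_UHP {C : Set ℂ} (h : IsHorizontalSlit C) : C ⊆ UHP := by
  obtain ⟨y, xl, xr, hy, -, rfl⟩ := h
  rintro z ⟨h1, -⟩
  change 0 < z.im
  rwa [h1]

lemma IsHorizontalSlit.isCompact {C : Set ℂ} (h : IsHorizontalSlit C) : IsCompact C := by
  obtain ⟨y, xl, xr, hy, -, rfl⟩ := h
  have : {z : ℂ | z.im = y ∧ z.re ∈ Icc xl xr} = (fun x : ℝ => (x : ℂ) + y * I) '' Icc xl xr := by
    ext z
    constructor
    · rintro ⟨h1, h2⟩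
      exact ⟨z.re, h2, by rw [← h1]; exact Complex.re_add_im z⟩
    · rintro ⟨x, hx, rfl⟩
      simpa using hx
  rw [this]
  exact isCompact_Icc.image (by fun_prop)

lemma isCompact_iUnion_slits {N : ℕ} {C : Fin N → Set ℂ} (h : ∀ j, IsHorizontalSlit (C j)) :
    IsCompact (⋃ j, C j) := isCompact_iUnion fun j => (h j).isCompact

lemma iUnion_slits_subset_UHP {N : ℕ} {C : Fin N → Set ℂ} (h : ∀ j, IsHorizontalSlit (C j)) :
    ⋃ j, C j ⊆ UHP := iUnion_subset fun j => (h j).subset_UHP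

namespace IsParallelSlitHalfPlane

variable {D : Set ℂ}

lemma subset_UHP (h : IsParallelSlitHalfPlane D) : D ⊆ UHP := by
  obtain ⟨N, C, -, -, rfl⟩ := h
  exact sdiff_subset

lemma isOpen (h : IsParallelSlitHalfPlane D) : IsOpen D := by
  obtain ⟨N, C, h1, -, rfl⟩ := h
  exact isOpen_UHP.sdiff (isCompact_iUnion_slits h1).isClosed

lemma exists_heights (h : IsParallelSlitHalfPlane D) :
    ∃ H : Set ℝ, H.Finite ∧ ∀ z ∈ UHP, z.im ∉ H → z ∈ D := by
  obtain ⟨N, C, h1, -, rfl⟩ := h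
  choose y xl xr hy hx hC using h1
  refine ⟨range y, finite_range y, fun z hz hzH => ⟨hz, ?_⟩⟩
  intro hm
  obtain ⟨j, hj⟩ := mem_iUnion.1 hm
  rw [hC j] at hj
  exact hzH ⟨j, hj.1.symm⟩

lemma exists_bound (h : IsParallelSlitHalfPlane D) :
    ∃ R : ℝ, 0 < R ∧ ∀ z ∈ UHP, R < ‖z‖ → z ∈ D := by
  obtain ⟨N, C, h1, -, rfl⟩ := h
  obtain ⟨R, hR, h2⟩ := (isCompact_iUnion_slits h1).isBounded.exists_pos_norm_le
  exact ⟨R, hR, fun z hz hzR => ⟨hz, fun hm => absurd (h2 z hm) (not_le.2 hzR)⟩⟩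

lemma isPreconnected_inter_norm_gt (h : IsParallelSlitHalfPlane D) (M : ℝ) :
    IsPreconnected (D ∩ {w : ℂ | M < ‖w‖}) := by
  obtain ⟨H, hH, hHD⟩ := h.exists_heights
  obtain ⟨R₀, hR₀, hRD⟩ := h.exists_bound
  set R := max R₀ |M| with hR
  have hRpos : 0 < R := lt_max_of_lt_left hR₀
  set W := D ∩ {w : ℂ | M < ‖w‖} with hW
  have hWo : IsOpen W := h.isOpen.inter (isOpen_lt continuous_const continuous_norm)
  have hout : ∀ z ∈ UHP, R < ‖z‖ → z ∈ W := fun z hz hzR =>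
    ⟨hRD z hz ((le_max_left _ _).trans_lt hzR),
      ((le_abs_self M).trans (le_max_right _ _)).trans_lt hzR⟩
  set A : Set ℂ := {z | R < z.re} ∩ UHP with hA
  set B : Set ℂ := {z | z.re < -R} ∩ UHP with hB
  set E : Set ℂ := {z | R < z.im} with hE
  have hUc : Convex ℝ UHP := convex_halfSpace_im_gt 0
  have hAc : Convex ℝ A := (convex_halfSpace_re_gt R).inter hUc
  have hBc : Convex ℝ B := (convex_halfSpace_re_lt (-R)).inter hUc
  have hEc : Convex ℝ E := convex_halfSpace_im_gt R
  set O : Set ℂ := (E ∪ A) ∪ B with hO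
  have hOp : IsPreconnected O := by
    refine IsPreconnected.union (-(R + 1) + (R + 1) * I : ℂ) (Or.inl ?_) ?_
      (hEc.isPreconnected.union ((R + 1) + (R + 1) * I : ℂ) ?_ ?_ hAc.isPreconnected)
      hBc.isPreconnected
    · simp [hE]
    · simp [hB, UHP]; linarith
    · simp [hE]
    · simp [hA, UHP]; linarith
  have hOW : O ⊆ W := by
    rintro z ((hz | hz) | hz)
    · exact hout z (hRpos.trans hz) (lt_of_lt_of_le hz ((le_abs_self _).trans (abs_im_le_norm z)))
    · exact hout z hz.2 (lt_of_lt_of_le hz.1 ((le_abs_self _).trans (abs_re_le_norm z)))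
    · refine hout z hz.2 (lt_of_lt_of_le ?_ ((neg_le_abs _).trans (abs_re_le_norm z)))
      have : z.re < -R := hz.1
      linarith
  have hEO : ((2 * R : ℝ) * I : ℂ) ∈ O := by
    refine Or.inl (Or.inl ?_)
    simp [hE]; linarith
  refine isPreconnected_of_forall ((2 * R : ℝ) * I : ℂ) fun w hw => ?_
  obtain ⟨r, hr, hball⟩ := Metric.isOpen_iff.1 hWo w hw
  have hwpos : 0 < w.im := h.subset_UHP hw.1
  obtain ⟨y, hy, hyH⟩ : ∃ y ∈ Ioo w.im (w.im + r), y ∉ H :=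
    ((Ioo_infinite (by linarith : w.im < w.im + r)).sdiff hH).nonempty
  -- an outward horizontal ray at height `y`
  obtain ⟨Q, hQc, hQ1, hQW, q, hqQ, hqO⟩ : ∃ Q : Set ℂ, Convex ℝ Q ∧ (⟨w.re, y⟩ : ℂ) ∈ Q ∧
      Q ⊆ W ∧ ∃ q ∈ Q, q ∈ O := by
    have hn : ∀ z : ℂ, z.im = y → |w.re| ≤ |z.re| → z ∈ W := by
      intro z hz1 hz2
      refine ⟨hHD z (by change 0 < z.im; rw [hz1]; linarith [hy.1]) (by rwa [hz1]), ?_⟩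
      refine lt_of_lt_of_le (show M < ‖w‖ from hw.2) ?_
      rw [← Real.sqrt_sq (norm_nonneg w), ← Real.sqrt_sq (norm_nonneg z)]
      refine Real.sqrt_le_sqrt ?_
      rw [Complex.sq_norm, Complex.sq_norm, Complex.normSq_apply, Complex.normSq_apply, hz1]
      have := sq_le_sq.2 hz2
      nlinarith [hy.1]
    rcases le_total 0 w.re with h0 | h0
    · refine ⟨({z | z.im ≤ y} ∩ {z | y ≤ z.im}) ∩ {z | w.re ≤ z.re},
        ((convex_halfSpace_im_le y).inter (convex_halfSpace_im_ge y)).inter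
          (convex_halfSpace_re_ge w.re), ⟨⟨le_refl y, le_refl y⟩, le_refl w.re⟩, ?_,
        ⟨w.re + R + 1, y⟩, ⟨⟨le_refl y, le_refl y⟩, ?_⟩, Or.inl (Or.inr ⟨?_, hwpos.trans hy.1⟩)⟩
      · rintro z ⟨⟨h1, h2⟩, h3⟩
        exact hn z (le_antisymm h1 h2) (abs_le_abs_of_nonneg h0 h3)
      · change w.re ≤ w.re + R + 1
        linarith
      · change R < w.re + R + 1
        linarith
    · refine ⟨({z | z.im ≤ y} ∩ {z | y ≤ z.im}) ∩ {z | z.re ≤ w.re},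
        ((convex_halfSpace_im_le y).inter (convex_halfSpace_im_ge y)).inter
          (convex_halfSpace_re_le w.re), ⟨⟨le_refl y, le_refl y⟩, le_refl w.re⟩, ?_,
        ⟨w.re - R - 1, y⟩, ⟨⟨le_refl y, le_refl y⟩, ?_⟩, Or.inr ⟨?_, hwpos.trans hy.1⟩⟩
      · rintro z ⟨⟨h1, h2⟩, h3⟩
        exact hn z (le_antisymm h1 h2) (abs_le_abs_of_nonpos h0 h3)
      · change w.re - R - 1 ≤ w.re
        linarith
      · change w.re - R - 1 < -R
        linarith
  refine ⟨(ball w r ∪ Q) ∪ O, union_subset (union_subset hball hQW) hOW, Or.inr hEO,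
    Or.inl (Or.inl (mem_ball_self hr)), ?_⟩
  refine IsPreconnected.union q (Or.inr hqQ) hqO ?_ hOp
  refine IsPreconnected.union (⟨w.re, y⟩ : ℂ) ?_ hQ1 (convex_ball w r).isPreconnected
    hQc.isPreconnected
  have hd : dist (⟨w.re, y⟩ : ℂ) w = dist y w.im := Complex.dist_of_re_eq rfl
  rw [mem_ball, hd, Real.dist_eq, abs_lt]
  constructor <;> linarith [hy.1, hy.2]

end IsParallelSlitHalfPlane

/-- The inverse of an injective holomorphic function is holomorphic. -/
lemma differentiableOn_of_leftInvOn {G : Set ℂ} {g φ : ℂ → ℂ} (hG : IsOpen G)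
    (hg : DifferentiableOn ℂ g G) (hφ : LeftInvOn φ g G) :
    DifferentiableOn ℂ φ (g '' G) := by
  have hinj : InjOn g G := hφ.injOn
  have hop : ∀ V ⊆ G, IsOpen V → IsOpen (g '' V) := fun V hV hVo =>
    isOpen_image_of_not_eventually_const hVo (hg.mono hV)
      (not_eventually_const_of_injOn hVo (hinj.mono hV))
  have hGo := hop G Subset.rfl hG
  have hcont : ∀ z ∈ G, ContinuousAt φ (g z) := by
    intro z hz
    rw [ContinuousAt, hφ hz]
    intro V hV
    obtain ⟨V', hV', hV'o, hzV'⟩ := _root_.mem_nhds_iff.1 (inter_mem hV (hG.mem_nhds hz))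
    have := (hop V' (hV'.trans inter_subset_right) hV'o).mem_nhds (mem_image_of_mem g hzV')
    rw [mem_map]
    refine mem_of_superset this ?_
    rintro _ ⟨u, hu, rfl⟩
    change φ (g u) ∈ V
    rw [hφ (hV' hu).2]
    exact (hV' hu).1
  have hdiff : ∀ z ∈ G, deriv g z ≠ 0 → DifferentiableAt ℂ φ (g z) := by
    intro z hz hne
    have h1 : HasDerivAt g (deriv g z) (φ (g z)) := by
      rw [hφ hz]; exact (hg.differentiableAt (hG.mem_nhds hz)).hasDerivAt
    refine (HasDerivAt.of_local_left_inverse (hcont z hz) h1 hne ?_).differentiableAt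
    filter_upwards [hGo.mem_nhds (mem_image_of_mem g hz)]
    rintro _ ⟨u, hu, rfl⟩
    rw [hφ hu]
  rintro _ ⟨z, hz, rfl⟩
  refine (Complex.analyticAt_of_differentiable_on_punctured_nhds_of_continuousAt ?_
    (hcont z hz)).differentiableAt.differentiableWithinAt
  have hgan : AnalyticAt ℂ g z := hg.analyticAt (hG.mem_nhds hz)
  rcases hgan.deriv.eventually_eq_zero_or_eventually_ne_zero with h | h
  · exfalso
    obtain ⟨r, hr, hball⟩ := Metric.mem_nhds_iff.1 (inter_mem h (hG.mem_nhds hz))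
    have hconst : ∀ w ∈ ball z r, g w = g z := fun w hw =>
      (convex_ball z r).is_const_of_fderivWithin_eq_zero (𝕜 := ℂ)
        (hg.mono fun v hv => (hball hv).2)
        (fun v hv => by
          rw [fderivWithin_of_isOpen isOpen_ball hv]
          ext
          simpa using (hball hv).1) hw (mem_ball_self hr)
    exact not_eventually_const_of_injOn hG hinj z hz
      (mem_of_superset (ball_mem_nhds z hr) hconst)
  · rw [eventually_nhdsWithin_iff]
    rw [eventually_nhdsWithin_iff] at h
    have h1 : ∀ᶠ w in 𝓝 (g z), φ w ∈ {u | u ∈ ({z}ᶜ : Set ℂ) → deriv g u ≠ 0} := by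
      refine (hcont z hz).eventually ?_
      rw [hφ hz]; exact h
    filter_upwards [h1, hGo.mem_nhds (mem_image_of_mem g hz)]
    rintro _ hw ⟨u, hu, rfl⟩ hne
    refine hdiff u hu ?_
    rw [hφ hu] at hw
    refine hw ?_
    rintro rfl
    exact hne rfl

/-- The data of a conformal map from the complement `U \ K` of a compact set `K` in a simply
connected domain `U` of the half-plane onto a parallel slit half-plane, normalized at infinity. -/
structure SlitMap (U K D : Set ℂ) (g : ℂ → ℂ) : Prop where
  isOpen : IsOpen U
  subset : U ⊆ UHP
  simply : IsSimplyConnected U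
  compact : IsCompact K
  compact_subset : K ⊆ U
  bound : ∃ R : ℝ, 0 < R ∧ ∀ z ∈ UHP, R ≤ ‖z‖ → z ∈ U \ K
  slit : IsParallelSlitHalfPlane D
  diff : DifferentiableOn ℂ g (U \ K)
  bij : BijOn g (U \ K) D
  lim : Tendsto (fun z => g z - z) (cobounded ℂ ⊓ 𝓟 (U \ K)) (𝓝 0)

namespace SlitMap

variable {U K D : Set ℂ} {g : ℂ → ℂ}

lemma isOpen_dom (h : SlitMap U K D g) : IsOpen (U \ K) := h.isOpen.sdiff h.compact.isClosed

lemma dom_subset (h : SlitMap U K D g) : U \ K ⊆ UHP := sdiff_subset.trans h.subset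

lemma im_pos (h : SlitMap U K D g) {z : ℂ} (hz : z ∈ U \ K) : 0 < z.im := h.dom_subset hz

lemma im_map_pos (h : SlitMap U K D g) {z : ℂ} (hz : z ∈ U \ K) : 0 < (g z).im :=
  h.slit.subset_UHP (h.bij.mapsTo hz)

lemma isOpen_image (h : SlitMap U K D g) {V : Set ℂ} (hV : V ⊆ U \ K) (hVo : IsOpen V) :
    IsOpen (g '' V) :=
  isOpen_image_of_not_eventually_const hVo (h.diff.mono hV)
    (not_eventually_const_of_injOn hVo (h.bij.injOn.mono hV))

/-- The inverse map. -/
def inv (_ : SlitMap U K D g) : ℂ → ℂ := Function.invFunOn g (U \ K)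

lemma inv_map (h : SlitMap U K D g) {z : ℂ} (hz : z ∈ U \ K) : h.inv (g z) = z :=
  h.bij.injOn.leftInvOn_invFunOn hz

lemma map_inv (h : SlitMap U K D g) {w : ℂ} (hw : w ∈ D) : g (h.inv w) = w :=
  h.bij.surjOn.rightInvOn_invFunOn hw

lemma inv_mem (h : SlitMap U K D g) {w : ℂ} (hw : w ∈ D) : h.inv w ∈ U \ K :=
  h.bij.surjOn.mapsTo_invFunOn hw

lemma differentiableOn_inv (h : SlitMap U K D g) : DifferentiableOn ℂ h.inv D := by
  have := differentiableOn_of_leftInvOn h.isOpen_dom h.diff (φ := h.inv) fun z hz => h.inv_map hz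
  rwa [h.bij.image_eq] at this

lemma injOn_inv (h : SlitMap U K D g) : InjOn h.inv D := fun a ha b hb hab => by
  rw [← h.map_inv ha, hab, h.map_inv hb]

lemma deriv_inv_ne_zero (h : SlitMap U K D g) {w : ℂ} (hw : w ∈ D) : deriv h.inv w ≠ 0 := by
  intro h0
  have h1 : HasDerivAt h.inv 0 w := by
    rw [← h0]
    exact (h.differentiableOn_inv.differentiableAt (h.slit.isOpen.mem_nhds hw)).hasDerivAt
  have h2 : HasDerivAt g (deriv g (h.inv w)) (h.inv w) :=
    (h.diff.differentiableAt (h.isOpen_dom.mem_nhds (h.inv_mem hw))).hasDerivAt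
  have h3 := h2.comp w h1
  have h4 : HasDerivAt (g ∘ h.inv) 1 w := by
    refine (hasDerivAt_id w).congr_of_eventuallyEq ?_
    filter_upwards [h.slit.isOpen.mem_nhds hw] with v hv
    exact h.map_inv hv
  simpa using h3.unique h4

lemma isPreconnected_slit (h : SlitMap U K D g) : IsPreconnected D := by
  have := h.slit.isPreconnected_inter_norm_gt (-1)
  rwa [inter_eq_self_of_subset_left] at this
  intro z _
  change (-1 : ℝ) < ‖z‖
  linarith [norm_nonneg z]

lemma isPreconnected_dom (h : SlitMap U K D g) : IsPreconnected (U \ K) := by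
  have : U \ K = h.inv '' D := by
    ext z
    constructor
    · exact fun hz => ⟨g z, h.bij.mapsTo hz, h.inv_map hz⟩
    · rintro ⟨w, hw, rfl⟩
      exact h.inv_mem hw
  rw [this]
  exact h.isPreconnected_slit.image _ h.differentiableOn_inv.continuousOn

lemma eventually_norm_sub_lt (h : SlitMap U K D g) {η : ℝ} (hη : 0 < η) :
    ∃ R : ℝ, 0 < R ∧ (∀ z ∈ UHP, R ≤ ‖z‖ → z ∈ U \ K) ∧
      ∀ z ∈ U \ K, R ≤ ‖z‖ → ‖g z - z‖ < η := by
  obtain ⟨R₀, hR₀, h₀⟩ := h.bound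
  have h1 := h.lim (ball_mem_nhds 0 hη)
  rw [mem_map, mem_inf_principal, hasBasis_cobounded_norm.mem_iff] at h1
  obtain ⟨R₁, -, h₁⟩ := h1
  refine ⟨max R₀ R₁, lt_max_of_lt_left hR₀, fun z hz hzR => h₀ z hz ((le_max_left _ _).trans hzR),
    fun z hz hzR => ?_⟩
  simpa using h₁ ((le_max_right _ _).trans hzR) hz

/-- A bound for the map on a circle propagates to the inside. -/
lemma norm_le_of_norm_eq (h : SlitMap U K D g) {ρ M : ℝ}
    (hM : ∀ z ∈ U \ K, ‖z‖ = ρ → ‖g z‖ ≤ M) : ∀ z ∈ U \ K, ‖z‖ < ρ → ‖g z‖ ≤ M := by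
  intro z hz hzρ
  by_contra! hlt
  have hW := h.slit.isPreconnected_inter_norm_gt M
  have h1 := h.isOpen_image (V := U \ K ∩ {z | ‖z‖ < ρ}) inter_subset_left
    (h.isOpen_dom.inter (isOpen_lt continuous_norm continuous_const))
  have h2 := h.isOpen_image (V := U \ K ∩ {z | ρ < ‖z‖}) inter_subset_left
    (h.isOpen_dom.inter (isOpen_lt continuous_const continuous_norm))
  obtain ⟨R, hR, hout, hclose⟩ := h.eventually_norm_sub_lt one_pos
  obtain ⟨w, -, ⟨a, ha, rfl⟩, b, hb, hab⟩ := hW _ _ h1 h2 (fun w hw => by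
      have hwm := h.inv_mem hw.1
      rcases lt_trichotomy ‖h.inv w‖ ρ with h3 | h3 | h3
      · exact Or.inl ⟨h.inv w, ⟨hwm, h3⟩, h.map_inv hw.1⟩
      · exfalso
        have h4 := hM _ hwm h3
        rw [h.map_inv hw.1] at h4
        exact absurd hw.2 (not_lt.2 h4)
      · exact Or.inr ⟨h.inv w, ⟨hwm, h3⟩, h.map_inv hw.1⟩)
    ⟨g z, ⟨h.bij.mapsTo hz, hlt⟩, mem_image_of_mem g ⟨hz, hzρ⟩⟩ (by
      set Y : ℝ := R + |M| + |ρ| + 2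
      have hYR : R < Y := by have := abs_nonneg M; have := abs_nonneg ρ; simp only [Y]; linarith
      have hYM : M + 1 < Y := by
        have := le_abs_self M; have := abs_nonneg ρ; simp only [Y]; linarith
      have hYρ : ρ < Y := by have := abs_nonneg M; have := le_abs_self ρ; simp only [Y]; linarith
      have hYn : ‖(Y * I : ℂ)‖ = Y := by
        simp [abs_of_pos (hR.trans hYR)]
      have hYm : (Y * I : ℂ) ∈ U \ K := hout _ (by simp [UHP]; linarith) (by rw [hYn]; exact hYR.le)
      refine ⟨g (Y * I), ⟨h.bij.mapsTo hYm, ?_⟩, mem_image_of_mem g ⟨hYm, ?_⟩⟩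
      · have h5 := hclose _ hYm (by rw [hYn]; exact hYR.le)
        have h6 := norm_sub_norm_le (Y * I : ℂ) (g (Y * I))
        rw [norm_sub_rev, hYn] at h6
        change M < _
        linarith
      · change ρ < _
        rwa [hYn])
  have := h.bij.injOn hb.1 ha.1 hab
  rw [this] at hb
  exact lt_asymm (show ‖a‖ < ρ from ha.2) hb.2

lemma exists_norm_le (h : SlitMap U K D g) (ρ : ℝ) :
    ∃ M : ℝ, 0 < M ∧ ∀ z ∈ U \ K, ‖z‖ ≤ ρ → ‖g z‖ ≤ M := by
  obtain ⟨R, hR, hout, hclose⟩ := h.eventually_norm_sub_lt one_pos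
  set r := max R (ρ + 1)
  refine ⟨r + 1, by have := le_max_left R (ρ + 1); linarith, fun z hz hzρ => ?_⟩
  refine h.norm_le_of_norm_eq (ρ := r) (fun w hw hwr => ?_) z hz
    (lt_of_lt_of_le (by linarith) (le_max_right _ _))
  have h5 := hclose w hw (by rw [hwr]; exact le_max_left _ _)
  have h6 := norm_sub_norm_le (g w) w
  linarith

/-- Near the boundary of its domain, the height of a slit map is close to the height of the
boundary of the image. -/
lemma exists_heights (h : SlitMap U K D g) : ∃ H : Set ℝ, H.Finite ∧ ∀ p ∉ U \ K, ∀ η > 0,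
    ∀ᶠ z in 𝓝[U \ K] p, ∃ y ∈ H, |(g z).im - y| < η := by
  obtain ⟨H, hH, hHD⟩ := h.slit.exists_heights
  refine ⟨insert 0 H, hH.insert 0, fun p hp η hη => ?_⟩
  obtain ⟨M, hM0, hM⟩ := h.exists_norm_le (‖p‖ + 1)
  set Kc : Set ℂ := {w | ‖w‖ ≤ M ∧ 0 ≤ w.im ∧ ∀ y ∈ insert 0 H, η ≤ |w.im - y|} with hKc
  have hKcc : IsCompact Kc := by
    refine Metric.isCompact_of_isClosed_isBounded ?_ ?_
    · simp only [hKc, ofPred_and, ofPred_forall]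
      refine (isClosed_le continuous_norm continuous_const).inter
        ((isClosed_le continuous_const continuous_im).inter ?_)
      refine isClosed_biInter fun y _ => isClosed_le continuous_const ?_
      exact (continuous_im.sub continuous_const).abs
    · exact (isBounded_iff_forall_norm_le.2 ⟨M, fun w hw => hw.1⟩)
  have hKcD : Kc ⊆ D := by
    rintro w ⟨-, h1, h2⟩
    refine hHD w (lt_of_le_of_ne h1 ?_) ?_
    · intro h3
      have := h2 0 (mem_insert _ _)
      rw [← h3] at this
      simp at this
      linarith
    · intro h3
      have := h2 w.im (mem_insert_of_mem _ h3)
      simp at this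
      linarith
  have hc : IsCompact (h.inv '' Kc) :=
    hKcc.image_of_continuousOn (h.differentiableOn_inv.continuousOn.mono hKcD)
  have hpc : p ∉ h.inv '' Kc := by
    rintro ⟨w, hw, rfl⟩
    exact hp (h.inv_mem (hKcD hw))
  have h1 : ∀ᶠ z in 𝓝 p, z ∉ h.inv '' Kc ∧ ‖z‖ < ‖p‖ + 1 :=
    (show ∀ᶠ z in 𝓝 p, z ∈ (h.inv '' Kc)ᶜ from hc.isClosed.isOpen_compl.mem_nhds hpc).and
      (continuous_norm.continuousAt.eventually (gt_mem_nhds (by linarith)))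
  rw [eventually_nhdsWithin_iff]
  filter_upwards [h1] with z hz hzG
  by_contra! hcon
  exact hz.1 ⟨g z, ⟨hM z hzG hz.2.le, (h.im_map_pos hzG).le, hcon⟩, h.inv_map hzG⟩

end SlitMap

/-- The (unnormalized) winding number around `z` of the image under `f` of the circle of radius `r`
about `0`. -/
def circleWinding (f : ℂ → ℂ) (r : ℝ) (z : ℂ) : ℂ := ∮ ζ in C(0, r), deriv f ζ / (f ζ - z)

section circleWinding

variable {Ω : Set ℂ} {f : ℂ → ℂ} {r : ℝ}

lemma circleIntegrable_deriv_div (hΩ : IsOpen Ω) (hf : DifferentiableOn ℂ f Ω) (hr : 0 ≤ r)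
    (hrΩ : sphere 0 r ⊆ Ω) {z : ℂ} (hz : ∀ ζ ∈ sphere (0 : ℂ) r, f ζ ≠ z) :
    CircleIntegrable (fun ζ => deriv f ζ / (f ζ - z)) 0 r := by
  refine ContinuousOn.circleIntegrable hr ?_
  refine ((hf.deriv hΩ).continuousOn.mono hrΩ).div
    ((hf.continuousOn.mono hrΩ).sub continuousOn_const) fun ζ hζ => sub_ne_zero.2 (hz ζ hζ)

lemma circleWinding_eq (hΩ : IsOpen Ω) (hf : DifferentiableOn ℂ f Ω) (hr : 0 ≤ r)
    (hrΩ : sphere 0 r ⊆ Ω) {z z' : ℂ} (h : ∀ ζ ∈ sphere (0 : ℂ) r, ‖z - z'‖ < ‖f ζ - z'‖) :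
    circleWinding f r z = circleWinding f r z' := by
  have hz' : ∀ ζ ∈ sphere (0 : ℂ) r, f ζ ≠ z' := by
    intro ζ hζ h0
    have := h ζ hζ
    rw [h0, sub_self, norm_zero] at this
    exact absurd this (not_lt.2 (norm_nonneg _))
  have hz : ∀ ζ ∈ sphere (0 : ℂ) r, f ζ ≠ z := by
    intro ζ hζ h0
    have := h ζ hζ
    rw [h0] at this
    exact lt_irrefl _ this
  rw [← sub_eq_zero, circleWinding, circleWinding, ← circleIntegral.integral_sub
    (circleIntegrable_deriv_div hΩ hf hr hrΩ hz) (circleIntegrable_deriv_div hΩ hf hr hrΩ hz')]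
  refine circleIntegral.integral_eq_zero_of_hasDerivWithinAt
    (f := fun ζ => log ((f ζ - z) / (f ζ - z'))) hr fun ζ hζ => ?_
  have hd : HasDerivAt f (deriv f ζ) ζ :=
    (hf.differentiableAt (hΩ.mem_nhds (hrΩ hζ))).hasDerivAt
  have h1 := sub_ne_zero.2 (hz ζ hζ)
  have h2 := sub_ne_zero.2 (hz' ζ hζ)
  have hs : (f ζ - z) / (f ζ - z') ∈ slitPlane := by
    have : (f ζ - z) / (f ζ - z') = 1 + (z' - z) / (f ζ - z') := by
      field_simp; ring
    rw [this]
    refine mem_slitPlane_of_norm_lt_one ?_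
    rw [norm_div, div_lt_one (norm_pos_iff.2 h2), norm_sub_rev]
    exact h ζ hζ
  have hq : HasDerivAt (fun ζ => (f ζ - z) / (f ζ - z'))
      ((deriv f ζ * (f ζ - z') - (f ζ - z) * deriv f ζ) / (f ζ - z') ^ 2) ζ :=
    (hd.sub_const z).div (hd.sub_const z') h2
  convert (hq.clog hs).hasDerivWithinAt using 1
  field_simp

lemma circleWinding_eq_zero_of_primitive (hΩ : IsOpen Ω) (hf : DifferentiableOn ℂ f Ω) (hr : 0 ≤ r)
    (hrΩ : sphere 0 r ⊆ Ω) {z : ℂ} {L : ℂ → ℂ}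
    (hL : ∀ ζ ∈ sphere (0 : ℂ) r, HasDerivAt L ((f ζ - z)⁻¹) (f ζ)) :
    circleWinding f r z = 0 := by
  refine circleIntegral.integral_eq_zero_of_hasDerivWithinAt
    (f := fun ζ => L (f ζ)) hr fun ζ hζ => ?_
  have hd : HasDerivAt f (deriv f ζ) ζ :=
    (hf.differentiableAt (hΩ.mem_nhds (hrΩ hζ))).hasDerivAt
  rw [div_eq_inv_mul]
  exact ((hL ζ hζ).comp ζ hd).hasDerivWithinAt

lemma circleWinding_eq_zero_of_im_lt (hΩ : IsOpen Ω) (hf : DifferentiableOn ℂ f Ω) (hr : 0 ≤ r)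
    (hrΩ : sphere 0 r ⊆ Ω) {z : ℂ} (hz : ∀ ζ ∈ sphere (0 : ℂ) r, (f ζ).im < z.im) :
    circleWinding f r z = 0 := by
  refine circleWinding_eq_zero_of_primitive hΩ hf hr hrΩ (L := fun w => log (I * (w - z)))
    fun ζ hζ => ?_
  have h1 : HasDerivAt (fun w => I * (w - z)) I (f ζ) := by
    simpa using ((hasDerivAt_id (f ζ)).sub_const z).const_mul I
  have h2 : I * (f ζ - z) ∈ slitPlane := by
    left
    simp
    exact hz ζ hζ
  convert h1.clog h2 using 1
  have : f ζ - z ≠ 0 := by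
    intro h
    rw [h] at h2
    simp at h2
  field_simp

lemma circleWinding_eqOn (hΩ : IsOpen Ω) (hf : DifferentiableOn ℂ f Ω) (hr : 0 ≤ r)
    (hrΩ : sphere 0 r ⊆ Ω) {Q : Set ℂ} (hQ : IsPreconnected Q)
    (hfQ : ∀ ζ ∈ sphere (0 : ℂ) r, f ζ ∉ Q) {z z' : ℂ} (hz : z ∈ Q) (hz' : z' ∈ Q) :
    circleWinding f r z = circleWinding f r z' := by
  refine hQ.induction₂ (fun a b => circleWinding f r a = circleWinding f r b) (fun x hx => ?_)
    (fun _ _ _ _ _ _ h1 h2 => h1.trans h2) (fun _ _ _ _ h => h.symm) hz hz'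
  have hc : IsClosed (f '' sphere 0 r) :=
    ((isCompact_sphere 0 r).image_of_continuousOn (hf.continuousOn.mono hrΩ)).isClosed
  have hx' : x ∉ f '' sphere 0 r := by
    rintro ⟨ζ, hζ, rfl⟩
    exact hfQ ζ hζ hx
  obtain ⟨δ, hδ, hball⟩ := Metric.isOpen_iff.1 hc.isOpen_compl x hx'
  refine mem_nhdsWithin_of_mem_nhds (mem_of_superset (ball_mem_nhds x hδ) fun y hy => ?_)
  refine (circleWinding_eq hΩ hf hr hrΩ fun ζ hζ => ?_).symm
  by_contra! hcon
  refine hball (a := f ζ) ?_ (mem_image_of_mem f hζ)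
  rw [mem_ball, dist_eq_norm]
  rw [mem_ball, dist_eq_norm] at hy
  linarith

/-- The winding number jumps by `2πi` when the circle crosses a simple preimage. -/
lemma circleWinding_sub (hΩ : IsOpen Ω) (hf : DifferentiableOn ℂ f Ω) (hinj : InjOn f Ω)
    (hd0 : ∀ ζ ∈ Ω, deriv f ζ ≠ 0) {r₁ r₀ : ℝ} {ζ₀ : ℂ} (hr₁ : 0 < r₁) (h1 : r₁ < ‖ζ₀‖)
    (h0 : ‖ζ₀‖ < r₀) (hΩr : closedBall 0 r₀ \ ball 0 r₁ ⊆ Ω) :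
    circleWinding f r₀ (f ζ₀) - circleWinding f r₁ (f ζ₀) = 2 * Real.pi * I := by
  have hζ₀ : ζ₀ ∈ Ω := hΩr ⟨by simpa using h0.le, by simpa using h1.le⟩
  set q : ℂ → ℂ := dslope f ζ₀ with hq
  have hqd : DifferentiableOn ℂ q Ω := (differentiableOn_dslope (hΩ.mem_nhds hζ₀)).2 hf
  have hq0 : ∀ ζ ∈ Ω, q ζ ≠ 0 := by
    intro ζ hζ h
    by_cases hne : ζ = ζ₀
    · rw [hne, hq, dslope_same] at h
      exact hd0 ζ₀ hζ₀ h
    · have h2 := sub_smul_dslope f ζ₀ ζ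
      rw [← hq, h, smul_zero] at h2
      exact hne (hinj hζ hζ₀ (sub_eq_zero.1 h2.symm))
  have hfq : ∀ ζ, f ζ - f ζ₀ = (ζ - ζ₀) * q ζ := fun ζ => (sub_smul_dslope f ζ₀ ζ).symm
  have hdq : ∀ ζ ∈ Ω, deriv f ζ = q ζ + (ζ - ζ₀) * deriv q ζ := by
    intro ζ hζ
    have h2 : HasDerivAt (fun ζ => (ζ - ζ₀) * q ζ) (1 * q ζ + (ζ - ζ₀) * deriv q ζ) ζ :=
      ((hasDerivAt_id ζ).sub_const ζ₀).mul (hqd.differentiableAt (hΩ.mem_nhds hζ)).hasDerivAt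
    have h3 : HasDerivAt f (1 * q ζ + (ζ - ζ₀) * deriv q ζ) ζ := by
      have h4 : f = fun ζ => (ζ - ζ₀) * q ζ + f ζ₀ := by
        funext ζ; rw [← hfq]; ring
      rw [h4]
      exact h2.add_const _
    rw [h3.deriv, one_mul]
  have hsplit : ∀ r, 0 < r → r ≠ ‖ζ₀‖ → sphere 0 r ⊆ Ω → circleWinding f r (f ζ₀) =
      (∮ ζ in C(0, r), (ζ - ζ₀)⁻¹) + ∮ ζ in C(0, r), (ζ - 0)⁻¹ • (ζ * (deriv q ζ / q ζ)) := by
    intro r hr hne hrΩ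
    have hsub : ∀ ζ ∈ sphere (0 : ℂ) r, ζ - ζ₀ ≠ 0 := by
      intro ζ hζ h
      rw [sub_eq_zero.1 h] at hζ
      exact hne (by simpa using hζ.symm)
    have hζ0 : ∀ ζ ∈ sphere (0 : ℂ) r, ζ ≠ 0 := by
      rintro ζ hζ rfl
      simp at hζ
      exact hr.ne hζ
    rw [← circleIntegral.integral_add]
    · refine circleIntegral.integral_congr hr.le fun ζ hζ => ?_
      have := hsub ζ hζ
      have := hq0 ζ (hrΩ hζ)
      have := hζ0 ζ hζ
      simp only [hfq, hdq ζ (hrΩ hζ), smul_eq_mul, sub_zero]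
      field_simp
    · refine ContinuousOn.circleIntegrable hr.le ?_
      exact ContinuousOn.inv₀ (by fun_prop) hsub
    · refine ContinuousOn.circleIntegrable hr.le ?_
      refine ContinuousOn.smul (f := fun ζ : ℂ => (ζ - 0)⁻¹) (ContinuousOn.inv₀ (by fun_prop)
        fun ζ hζ => by simpa using hζ0 ζ hζ) ?_
      refine continuousOn_id.mul ?_
      exact ((hqd.deriv hΩ).continuousOn.mono hrΩ).div (hqd.continuousOn.mono hrΩ)
        fun ζ hζ => hq0 ζ (hrΩ hζ)
  have hr₀ : 0 < r₀ := hr₁.trans (h1.trans h0)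
  rw [hsplit r₀ hr₀ h0.ne' fun ζ hζ => hΩr ⟨sphere_subset_closedBall hζ, by
      rw [mem_sphere_zero_iff_norm] at hζ
      simp [hζ]; linarith⟩,
    hsplit r₁ hr₁ h1.ne fun ζ hζ => hΩr ⟨by
      rw [mem_sphere_zero_iff_norm] at hζ
      simp [hζ]; linarith, by
      rw [mem_sphere_zero_iff_norm] at hζ
      simp [hζ]⟩]
  have hann : (∮ ζ in C(0, r₀), (ζ - 0)⁻¹ • (ζ * (deriv q ζ / q ζ))) =
      ∮ ζ in C(0, r₁), (ζ - 0)⁻¹ • (ζ * (deriv q ζ / q ζ)) := by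
    have hdiff : DifferentiableOn ℂ (fun ζ => ζ * (deriv q ζ / q ζ)) Ω :=
      differentiableOn_id.mul ((hqd.deriv hΩ).div hqd hq0)
    refine circleIntegral_sub_center_inv_smul_eq_of_differentiable_on_annulus_off_countable hr₁
      (h1.trans h0).le countable_empty (hdiff.continuousOn.mono hΩr) fun ζ hζ => ?_
    refine hdiff.differentiableAt (hΩ.mem_nhds (hΩr ⟨ball_subset_closedBall hζ.1.1, fun h => ?_⟩))
    exact hζ.1.2 (ball_subset_closedBall h)
  have hin : (∮ ζ in C(0, r₀), (ζ - ζ₀)⁻¹) = 2 * Real.pi * I :=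
    circleIntegral.integral_sub_inv_of_mem_ball (by simpa using h0)
  have hout : (∮ ζ in C(0, r₁), (ζ - ζ₀)⁻¹) = 0 := by
    have hne : ∀ ζ ∈ closedBall (0 : ℂ) r₁, ζ - ζ₀ ≠ 0 := by
      intro ζ hζ h
      rw [sub_eq_zero.1 h, mem_closedBall_zero_iff] at hζ
      linarith
    refine circleIntegral_eq_zero_of_differentiable_on_off_countable hr₁.le countable_empty
      (ContinuousOn.inv₀ (by fun_prop) hne) fun ζ hζ => ?_
    exact DifferentiableAt.inv (by fun_prop) (hne ζ (ball_subset_closedBall hζ.1))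
  rw [hann, hin, hout]
  ring

end circleWinding

lemma IsHorizontalSlit.exists_center {C : Set ℂ} (h : IsHorizontalSlit C) :
    ∃ c : ℂ, ∃ l : ℝ, 0 < l ∧ C = (fun x : ℝ => c + l * x) '' Icc (-1) 1 := by
  obtain ⟨y, xl, xr, -, hx, rfl⟩ := h
  refine ⟨⟨(xl + xr) / 2, y⟩, (xr - xl) / 2, by linarith, ?_⟩
  ext z
  constructor
  · rintro ⟨h1, h2, h3⟩
    refine ⟨(z.re - (xl + xr) / 2) / ((xr - xl) / 2), ⟨?_, ?_⟩, ?_⟩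
    · rw [le_div_iff₀ (by linarith)]; linarith
    · rw [div_le_iff₀ (by linarith)]; linarith
    · have : xr - xl ≠ 0 := by linarith
      apply Complex.ext
      · simp only [add_re, ← ofReal_mul, ofReal_re]
        field_simp; ring
      · simp only [add_im, ← ofReal_mul, ofReal_im]
        rw [h1]; ring
  · rintro ⟨x, ⟨h1, h2⟩, rfl⟩
    refine ⟨?_, ?_, ?_⟩
    · simp only [add_im, ← ofReal_mul, ofReal_im]; ring
    · simp only [add_re, ← ofReal_mul, ofReal_re]; nlinarith
    · simp only [add_re, ← ofReal_mul, ofReal_re]; nlinarith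

/-- The Joukowski map, from the exterior of the unit disc onto the complement of a segment. -/
def joukowski (c : ℂ) (l : ℝ) (ζ : ℂ) : ℂ := c + l * ((ζ + ζ⁻¹) / 2)

section joukowski

variable {c : ℂ} {l : ℝ}

lemma joukowski_hasDerivAt {ζ : ℂ} (hζ : ζ ≠ 0) :
    HasDerivAt (joukowski c l) (l * ((1 + -(ζ ^ 2)⁻¹) / 2)) ζ :=
  ((((hasDerivAt_id ζ).add (hasDerivAt_inv hζ)).div_const 2).const_mul (l : ℂ)).const_add c

lemma joukowski_deriv_ne_zero (hl : 0 < l) {ζ : ℂ} (hζ : 1 < ‖ζ‖) :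
    deriv (joukowski c l) ζ ≠ 0 := by
  have h0 : ζ ≠ 0 := by rintro rfl; simp at hζ; linarith
  rw [(joukowski_hasDerivAt h0).deriv]
  intro h
  have hl' : (l : ℂ) ≠ 0 := by exact_mod_cast hl.ne'
  have h1 : (ζ ^ 2) = 1 := by
    have : 1 + -(ζ ^ 2)⁻¹ = 0 := by simpa [hl'] using h
    field_simp at this
    linear_combination this
  have h2 := congrArg norm h1
  rw [norm_pow, norm_one] at h2
  nlinarith

lemma joukowski_injOn (hl : 0 < l) : InjOn (joukowski c l) {ζ | 1 < ‖ζ‖} := by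
  intro a ha b hb hab
  have ha' : 1 < ‖a‖ := ha
  have hb' : 1 < ‖b‖ := hb
  have ha0 : a ≠ 0 := by rintro rfl; simp at ha'; linarith
  have hb0 : b ≠ 0 := by rintro rfl; simp at hb'; linarith
  have hl' : (l : ℂ) ≠ 0 := by exact_mod_cast hl.ne'
  have h1 : a + a⁻¹ = b + b⁻¹ := by simpa [joukowski, hl'] using hab
  have h2 : (a - b) * (a * b - 1) = 0 := by
    field_simp at h1
    linear_combination h1
  rcases mul_eq_zero.1 h2 with h | h
  · exact sub_eq_zero.1 h
  · have h3 := congrArg norm (sub_eq_zero.1 h)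
    rw [norm_mul, norm_one] at h3
    nlinarith

lemma norm_sub_one_add_norm_add_one {ζ : ℂ} (hζ : ζ ≠ 0) :
    ‖(ζ + ζ⁻¹) / 2 - 1‖ + ‖(ζ + ζ⁻¹) / 2 + 1‖ = ‖ζ‖ + ‖ζ‖⁻¹ := by
  have hn : ‖ζ‖ ≠ 0 := norm_ne_zero_iff.2 hζ
  have h1 : (ζ + ζ⁻¹) / 2 - 1 = (ζ - 1) ^ 2 / (2 * ζ) := by field_simp; ring
  have h2 : (ζ + ζ⁻¹) / 2 + 1 = (ζ + 1) ^ 2 / (2 * ζ) := by field_simp; ring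
  have h3 : ‖ζ - 1‖ ^ 2 + ‖ζ + 1‖ ^ 2 = 2 * (‖ζ‖ ^ 2 + 1) := by
    simp only [Complex.sq_norm, normSq_apply]
    simp
    ring
  rw [h1, h2]
  simp only [norm_div, norm_pow, norm_mul, Complex.norm_ofNat]
  rw [← add_div, h3]
  field_simp

lemma exists_joukowski_eq (hl : 0 < l) (w : ℂ) : ∃ ζ : ℂ, 1 ≤ ‖ζ‖ ∧ joukowski c l ζ = w := by
  have hl' : (l : ℂ) ≠ 0 := by exact_mod_cast hl.ne'
  set u := (w - c) / l with hu
  obtain ⟨s, hs⟩ := IsAlgClosed.exists_pow_nat_eq (u ^ 2 - 1) (n := 2) two_pos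
  have hprod : (u + s) * (u - s) = 1 := by linear_combination -hs
  have key : ∀ a b : ℂ, a * b = 1 → a + b = 2 * u → joukowski c l a = w := by
    intro a b hab hs
    have hb : a⁻¹ = b := inv_eq_of_mul_eq_one_right hab
    rw [joukowski, hb, hs, hu]
    field_simp
    ring
  rcases le_total 1 ‖u + s‖ with h | h
  · exact ⟨u + s, h, key _ (u - s) hprod (by ring)⟩
  · refine ⟨u - s, ?_, key _ (u + s) (by rw [mul_comm]; exact hprod) (by ring)⟩
    have h1 := congrArg norm hprod
    rw [norm_mul, norm_one] at h1
    nlinarith [norm_nonneg (u - s)]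

lemma joukowski_mem_of_norm_eq_one {ζ : ℂ} (hζ : ‖ζ‖ = 1) :
    joukowski c l ζ ∈ (fun x : ℝ => c + l * x) '' Icc (-1) 1 := by
  have h1 : ζ⁻¹ = (starRingEnd ℂ) ζ := by
    rw [Complex.inv_def, Complex.normSq_eq_norm_sq, hζ]; simp
  have h2 := abs_re_le_norm ζ
  rw [hζ] at h2
  refine ⟨ζ.re, abs_le.1 h2, ?_⟩
  simp only [joukowski, h1, Complex.add_conj]
  push_cast
  ring

lemma joukowski_notMem (hl : 0 < l) {ζ : ℂ} (hζ : 1 < ‖ζ‖) :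
    joukowski c l ζ ∉ (fun x : ℝ => c + l * x) '' Icc (-1) 1 := by
  rintro ⟨x, ⟨hx1, hx2⟩, h⟩
  have hl' : (l : ℂ) ≠ 0 := by exact_mod_cast hl.ne'
  have h0 : ζ ≠ 0 := by rintro rfl; simp at hζ; linarith
  have h1 : (ζ + ζ⁻¹) / 2 = x := by
    have : c + l * x = c + l * ((ζ + ζ⁻¹) / 2) := h
    exact (mul_left_cancel₀ hl' (add_left_cancel this)).symm
  have h2 := norm_sub_one_add_norm_add_one h0
  rw [h1] at h2
  have h3 : ‖(x : ℂ) - 1‖ = 1 - x := by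
    rw [← ofReal_one, ← ofReal_sub, norm_real, Real.norm_eq_abs, abs_of_nonpos (by linarith)]
    ring
  have h4 : ‖(x : ℂ) + 1‖ = 1 + x := by
    rw [← ofReal_one, ← ofReal_add, norm_real, Real.norm_eq_abs, abs_of_nonneg (by linarith)]
    ring
  rw [h3, h4] at h2
  have h5 : ‖ζ‖ * ‖ζ‖⁻¹ = 1 := mul_inv_cancel₀ (by linarith)
  nlinarith [sq_nonneg (‖ζ‖ - ‖ζ‖⁻¹)]

lemma exists_dist_joukowski_le (hl : 0 < l) {ζ : ℂ} (hζ : 1 < ‖ζ‖) :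
    ∃ w ∈ (fun x : ℝ => c + l * x) '' Icc (-1) 1, dist (joukowski c l ζ) w ≤ l * (‖ζ‖ - 1) := by
  have h0 : ζ ≠ 0 := by rintro rfl; simp at hζ; linarith
  have hn : (‖ζ‖ : ℂ) ≠ 0 := by exact_mod_cast (norm_ne_zero_iff.2 h0)
  set u : ℂ := ζ / ‖ζ‖ with hu
  have hu1 : ‖u‖ = 1 := by
    rw [hu, norm_div, norm_real, norm_norm, div_self (norm_ne_zero_iff.2 h0)]
  have hu0 : u ≠ 0 := by rw [← norm_ne_zero_iff, hu1]; exact one_ne_zero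
  have hζu : ζ = ‖ζ‖ * u := by rw [hu]; field_simp
  refine ⟨_, joukowski_mem_of_norm_eq_one hu1, ?_⟩
  have h1 : joukowski c l ζ - joukowski c l u = l * ((‖ζ‖ - 1) * (u - ζ⁻¹) / 2) := by
    simp only [joukowski]
    have : ζ⁻¹ = (‖ζ‖ : ℂ)⁻¹ * u⁻¹ := by rw [← mul_inv, ← hζu]
    rw [this]
    nth_rewrite 1 [hζu]
    field_simp
    ring
  have h2 : ‖u - ζ⁻¹‖ ≤ 2 := by
    refine (norm_sub_le _ _).trans ?_
    rw [hu1, norm_inv]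
    have : ‖ζ‖⁻¹ ≤ 1 := inv_le_one_of_one_le₀ hζ.le
    linarith
  rw [dist_eq_norm, h1, norm_mul, norm_div, norm_mul, norm_real, Real.norm_eq_abs, abs_of_pos hl]
  have h3 : ‖(‖ζ‖ : ℂ) - 1‖ = ‖ζ‖ - 1 := by
    rw [← ofReal_one, ← ofReal_sub, norm_real, Real.norm_eq_abs, abs_of_pos (by linarith)]
  rw [h3, Complex.norm_ofNat]
  refine mul_le_mul_of_nonneg_left ?_ hl.le
  nlinarith

end joukowski

namespace SlitMap

variable {U K D : Set ℂ} {g : ℂ → ℂ}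

lemma exists_norm_inv_le (h : SlitMap U K D g) (ρ : ℝ) :
    ∃ B : ℝ, ∀ w ∈ D, ‖w‖ ≤ ρ → ‖h.inv w‖ ≤ B := by
  obtain ⟨R, hR, -, hclose⟩ := h.eventually_norm_sub_lt one_pos
  refine ⟨max R (ρ + 1), fun w hw hwρ => ?_⟩
  rcases le_total ‖h.inv w‖ R with h1 | h1
  · exact h1.trans (le_max_left _ _)
  · refine le_trans ?_ (le_max_right _ _)
    have h2 := hclose _ (h.inv_mem hw) h1
    rw [h.map_inv hw, norm_sub_rev] at h2
    have h3 := norm_sub_norm_le (h.inv w) w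
    linarith

/-- Points near the boundary of `U` are not mapped near a slit. -/
lemma exists_isOpen_superset_slit (h : SlitMap U K D g) {C V : Set ℂ} (hC : IsHorizontalSlit C)
    (hV : IsOpen V) (hCV : C ⊆ V) (hVD : V \ C ⊆ D) (hCD : Disjoint C D) {p : ℂ} (hp : p ∉ U) :
    ∃ O : Set ℂ, IsOpen O ∧ C ⊆ O ∧ ∀ᶠ z in 𝓝[U \ K] p, g z ∉ O := by
  have hCc := hC.isCompact
  obtain ⟨c, l, hl, hCeq⟩ := hC.exists_center
  set J := joukowski c l with hJ
  obtain ⟨d, hd, hthick⟩ := hCc.exists_thickening_subset_open hV hCV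
  set δ : ℝ := d / l with hδ
  have hδpos : 0 < δ := div_pos hd hl
  have hldδ : l * δ = d := by rw [hδ]; field_simp
  have hJthick : ∀ ζ : ℂ, 1 < ‖ζ‖ → ∃ w ∈ C, dist (J ζ) w ≤ l * (‖ζ‖ - 1) := by
    intro ζ hζ
    rw [hCeq]
    exact exists_dist_joukowski_le hl hζ
  set Ω : Set ℂ := {ζ | 1 < ‖ζ‖ ∧ ‖ζ‖ < 1 + δ} with hΩdef
  have hΩ : IsOpen Ω :=
    (isOpen_lt continuous_const continuous_norm).inter (isOpen_lt continuous_norm continuous_const)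
  have hJD : ∀ ζ ∈ Ω, J ζ ∈ D := by
    rintro ζ ⟨h1, h2⟩
    refine hVD ⟨hthick ?_, ?_⟩
    · obtain ⟨w, hw, hdist⟩ := hJthick ζ h1
      refine mem_thickening_iff.2 ⟨w, hw, hdist.trans_lt ?_⟩
      rw [← hldδ]
      exact mul_lt_mul_of_pos_left (by linarith) hl
    · rw [hCeq]; exact joukowski_notMem hl h1
  have hne0 : ∀ ζ ∈ Ω, ζ ≠ 0 := by
    rintro ζ ⟨h1, -⟩ rfl
    simp at h1; linarith
  set Ψ : ℂ → ℂ := fun ζ => h.inv (J ζ) with hΨ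
  have hΨd : ∀ ζ ∈ Ω, HasDerivAt Ψ (deriv h.inv (J ζ) * deriv J ζ) ζ := by
    intro ζ hζ
    have h1 : HasDerivAt h.inv (deriv h.inv (J ζ)) (J ζ) :=
      (h.differentiableOn_inv.differentiableAt (h.slit.isOpen.mem_nhds (hJD ζ hζ))).hasDerivAt
    exact h1.comp ζ (joukowski_hasDerivAt (hne0 ζ hζ)).differentiableAt.hasDerivAt
  have hΨdiff : DifferentiableOn ℂ Ψ Ω := fun ζ hζ =>
    (hΨd ζ hζ).differentiableAt.differentiableWithinAt
  have hΨne : ∀ ζ ∈ Ω, deriv Ψ ζ ≠ 0 := by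
    intro ζ hζ
    rw [(hΨd ζ hζ).deriv]
    exact mul_ne_zero (h.deriv_inv_ne_zero (hJD ζ hζ)) (joukowski_deriv_ne_zero hl hζ.1)
  have hΨinj : InjOn Ψ Ω := fun a ha b hb hab =>
    joukowski_injOn hl ha.1 hb.1 (h.injOn_inv (hJD a ha) (hJD b hb) hab)
  have hΨm : ∀ ζ ∈ Ω, Ψ ζ ∈ U \ K := fun ζ hζ => h.inv_mem (hJD ζ hζ)
  -- a height bound for `Ψ`
  obtain ⟨B, hB⟩ : ∃ B, ∀ ζ ∈ Ω, ‖Ψ ζ‖ ≤ B := by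
    obtain ⟨b, hb⟩ := (hCc.isBounded.thickening (δ := d)).exists_norm_le
    obtain ⟨B, hB⟩ := h.exists_norm_inv_le b
    refine ⟨B, fun ζ hζ => hB _ (hJD ζ hζ) (hb _ ?_)⟩
    obtain ⟨w, hw, hdist⟩ := hJthick ζ hζ.1
    refine mem_thickening_iff.2 ⟨w, hw, hdist.trans_lt ?_⟩
    rw [← hldδ]
    exact mul_lt_mul_of_pos_left (by linarith [hζ.2]) hl
  obtain ⟨R, hR, hout⟩ := h.bound
  set Y : ℝ := max R (B + 1) with hY
  have hYpos : 0 < Y := lt_max_of_lt_left hR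
  have hYn : ‖(Y * I : ℂ)‖ = Y := by simp [abs_of_pos hYpos]
  have hYm : (Y * I : ℂ) ∈ U \ K := hout _ (by simpa [UHP] using hYpos)
    (by rw [hYn]; exact le_max_left _ _)
  set r₀ : ℝ := 1 + δ / 2 with hr₀
  have hr₀1 : 1 < r₀ := by linarith
  have hsph : ∀ r, 1 < r → r ≤ r₀ → sphere (0 : ℂ) r ⊆ Ω := by
    intro r hr hrr ζ hζ
    rw [mem_sphere_zero_iff_norm] at hζ
    exact ⟨by rw [hζ]; exact hr, by rw [hζ]; linarith⟩
  refine ⟨{w | ‖(w - c) / l - 1‖ + ‖(w - c) / l + 1‖ < r₀ + r₀⁻¹},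
    isOpen_lt (by fun_prop) continuous_const, ?_, ?_⟩
  · have hl' : (l : ℂ) ≠ 0 := by exact_mod_cast hl.ne'
    rw [hCeq]
    rintro _ ⟨x, ⟨hx1, hx2⟩, rfl⟩
    have h3 : ‖(x : ℂ) - 1‖ = 1 - x := by
      rw [← ofReal_one, ← ofReal_sub, norm_real, Real.norm_eq_abs, abs_of_nonpos (by linarith)]
      ring
    have h4 : ‖(x : ℂ) + 1‖ = 1 + x := by
      rw [← ofReal_one, ← ofReal_add, norm_real, Real.norm_eq_abs, abs_of_nonneg (by linarith)]
      ring
    have h5 : (c + l * x - c) / l = (x : ℂ) := by field_simp; ring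
    change ‖(c + l * x - c) / l - 1‖ + ‖(c + l * x - c) / l + 1‖ < r₀ + r₀⁻¹
    rw [h5, h3, h4]
    have h6 : r₀ * r₀⁻¹ = 1 := mul_inv_cancel₀ (by linarith)
    nlinarith [sq_nonneg (r₀ - 1), inv_pos.2 (show 0 < r₀ by linarith)]
  · have hcomp : IsCompact (Ψ '' sphere 0 r₀) :=
      (isCompact_sphere 0 r₀).image_of_continuousOn
        (hΨdiff.continuousOn.mono (hsph r₀ hr₀1 le_rfl))
    have hpn : p ∉ Ψ '' sphere 0 r₀ := by
      rintro ⟨ζ, hζ, rfl⟩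
      exact hp (hΨm ζ (hsph r₀ hr₀1 le_rfl hζ)).1
    obtain ⟨η, hη, hball⟩ := Metric.isOpen_iff.1 hcomp.isClosed.isOpen_compl p hpn
    obtain ⟨L, hL⟩ := exists_primitive_inv_sub h.isOpen h.simply hp
    rw [eventually_nhdsWithin_iff]
    filter_upwards [ball_mem_nhds p hη] with z hzη hzG hzO
    -- the preimage of `z` in the annulus
    have hgzC : g z ∉ C := fun hgC => hCD.le_bot ⟨hgC, h.bij.mapsTo hzG⟩
    obtain ⟨ζ₀, hζ₀1, hζ₀⟩ := exists_joukowski_eq (c := c) hl (g z)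
    have hζ₀lt : 1 < ‖ζ₀‖ := lt_of_le_of_ne hζ₀1 fun h1 => hgzC (by
      rw [hCeq, ← hζ₀]; exact joukowski_mem_of_norm_eq_one h1.symm)
    have hζ₀r : ‖ζ₀‖ < r₀ := by
      have h0 : ζ₀ ≠ 0 := by rintro rfl; simp at hζ₀lt; linarith
      have hl' : (l : ℂ) ≠ 0 := by exact_mod_cast hl.ne'
      have h1 := norm_sub_one_add_norm_add_one h0
      have h2 : (g z - c) / l = (ζ₀ + ζ₀⁻¹) / 2 := by
        rw [← hζ₀, joukowski]; field_simp; ring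
      have h3 : ‖(g z - c) / l - 1‖ + ‖(g z - c) / l + 1‖ < r₀ + r₀⁻¹ := hzO
      rw [h2, h1] at h3
      by_contra! h4
      have h5 : ‖ζ₀‖ * ‖ζ₀‖⁻¹ = 1 := mul_inv_cancel₀ (by linarith)
      have h6 : r₀ * r₀⁻¹ = 1 := mul_inv_cancel₀ (by linarith)
      have h7 : r₀⁻¹ ≤ 1 := inv_le_one_of_one_le₀ hr₀1.le
      have h8 : 0 < r₀⁻¹ := inv_pos.2 (by linarith)
      have h9 : 0 < ‖ζ₀‖⁻¹ := inv_pos.2 (by linarith)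
      have h10 : r₀⁻¹ * ‖ζ₀‖⁻¹ ≤ 1 := by
        have : ‖ζ₀‖⁻¹ ≤ 1 := inv_le_one_of_one_le₀ hζ₀1
        nlinarith
      have h11 : r₀⁻¹ - ‖ζ₀‖⁻¹ = (‖ζ₀‖ - r₀) * (r₀⁻¹ * ‖ζ₀‖⁻¹) := by
        linear_combination (-r₀⁻¹) * h5 + ‖ζ₀‖⁻¹ * h6
      nlinarith
    have hζ₀Ω : ζ₀ ∈ Ω := ⟨hζ₀lt, by linarith⟩
    have hΨζ₀ : Ψ ζ₀ = z := by rw [hΨ]; simp only [hJ, hζ₀]; exact h.inv_map hzG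
    -- the outer winding number vanishes
    have hN₀ : circleWinding Ψ r₀ z = 0 := by
      rw [circleWinding_eq hΩ hΨdiff (by linarith) (hsph r₀ hr₀1 le_rfl) (z' := p)]
      · exact circleWinding_eq_zero_of_primitive hΩ hΨdiff (by linarith) (hsph r₀ hr₀1 le_rfl)
          fun ζ hζ => hL _ (hΨm ζ (hsph r₀ hr₀1 le_rfl hζ)).1
      · intro ζ hζ
        by_contra! hcon
        refine hball (a := Ψ ζ) ?_ (mem_image_of_mem Ψ hζ)
        rw [mem_ball, dist_eq_norm] at hzη ⊢
        linarith
    -- the inner winding number vanishes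
    obtain ⟨P, hPc, hPp, hPD, hzP, hYP⟩ : ∃ P : Set ℂ, IsCompact P ∧ IsPreconnected P ∧ P ⊆ D ∧
        g z ∈ P ∧ g (Y * I) ∈ P := by
      have hpc := h.slit.isOpen.isConnected_iff_isPathConnected.1
        ⟨⟨_, h.bij.mapsTo hzG⟩, h.isPreconnected_slit⟩
      obtain ⟨γ, hγ⟩ := hpc.joinedIn _ (h.bij.mapsTo hzG) _ (h.bij.mapsTo hYm)
      exact ⟨range γ, isCompact_range γ.continuous, isPreconnected_range γ.continuous,
        range_subset_iff.2 hγ, ⟨0, γ.source⟩, ⟨1, γ.target⟩⟩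
    obtain ⟨d', hd', hthick'⟩ := hCc.exists_thickening_subset_open hPc.isClosed.isOpen_compl
      (fun w hw hwP => hCD.le_bot ⟨hw, hPD hwP⟩)
    obtain ⟨r₁, hr₁1, hr₁⟩ : ∃ r₁, 1 < r₁ ∧ r₁ < min ‖ζ₀‖ (1 + d' / l) :=
      exists_between (lt_min hζ₀lt (by have := div_pos hd' hl; linarith))
    have hr₁ζ : r₁ < ‖ζ₀‖ := hr₁.trans_le (min_le_left _ _)
    have hr₁r : r₁ ≤ r₀ := by linarith
    have hN₁ : circleWinding Ψ r₁ z = 0 := by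
      rw [circleWinding_eqOn hΩ hΨdiff (by linarith) (hsph r₁ hr₁1 hr₁r) (Q := h.inv '' P)
        (hPp.image _ (h.differentiableOn_inv.continuousOn.mono hPD)) ?_
        ⟨g z, hzP, h.inv_map hzG⟩ ⟨_, hYP, h.inv_map hYm⟩]
      · refine circleWinding_eq_zero_of_im_lt hΩ hΨdiff (by linarith) (hsph r₁ hr₁1 hr₁r)
          fun ζ hζ => ?_
        have h1 := hB ζ (hsph r₁ hr₁1 hr₁r hζ)
        have h2 := (le_abs_self _).trans (abs_im_le_norm (Ψ ζ))
        have h3 := le_max_right R (B + 1)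
        simp
        linarith
      · rintro ζ hζ ⟨w, hwP, hw⟩
        have hζΩ := hsph r₁ hr₁1 hr₁r hζ
        have h1 : w = J ζ := h.injOn_inv (hPD hwP) (hJD ζ hζΩ) hw
        obtain ⟨v, hv, hdist⟩ := hJthick ζ hζΩ.1
        rw [← h1] at hdist
        refine hthick' (mem_thickening_iff.2 ⟨v, hv, hdist.trans_lt ?_⟩) hwP
        rw [mem_sphere_zero_iff_norm.1 hζ, mul_comm, ← lt_div_iff₀ hl]
        linarith [hr₁.trans_le (min_le_right _ _)]
    have h3 := circleWinding_sub hΩ hΨdiff hΨinj hΨne (by linarith) hr₁ζ hζ₀r (by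
      rintro ζ ⟨h1, h2⟩
      rw [mem_closedBall_zero_iff] at h1
      rw [mem_ball_zero_iff, not_lt] at h2
      exact ⟨by linarith, by linarith⟩)
    rw [hΨζ₀, hN₀, hN₁, sub_zero] at h3
    exact two_pi_I_ne_zero h3.symm

/-- Near the boundary of `U` the image tends to the real axis. -/
lemma eventually_im_lt (h : SlitMap U K D g) {p : ℂ} (hp : p ∉ U) {η : ℝ} (hη : 0 < η) :
    ∀ᶠ z in 𝓝[U \ K] p, (g z).im < η := by
  obtain ⟨N, C, hC, hdisj, hD⟩ := id h.slit
  have h1 : ∀ k, ∃ O : Set ℂ, IsOpen O ∧ C k ⊆ O ∧ ∀ᶠ z in 𝓝[U \ K] p, g z ∉ O := by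
    intro k
    refine h.exists_isOpen_superset_slit (V := UHP \ ⋃ j ∈ {j | j ≠ k}, C j) (hC k) ?_ ?_ ?_ ?_ hp
    · refine isOpen_UHP.sdiff ?_
      exact (toFinite {j | j ≠ k}).isClosed_biUnion fun j _ => (hC j).isCompact.isClosed
    · intro z hz
      refine ⟨(hC k).subset_UHP hz, fun hm => ?_⟩
      obtain ⟨j, hj, hzj⟩ := mem_iUnion₂.1 hm
      exact (hdisj hj).le_bot ⟨hzj, hz⟩
    · rintro z ⟨⟨hz1, hz2⟩, hz3⟩
      rw [hD]
      refine ⟨hz1, fun hm => ?_⟩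
      obtain ⟨j, hzj⟩ := mem_iUnion.1 hm
      by_cases hjk : j = k
      · exact hz3 (hjk ▸ hzj)
      · exact hz2 (mem_iUnion₂.2 ⟨j, hjk, hzj⟩)
    · rw [hD, disjoint_left]
      rintro z hz ⟨-, hz2⟩
      exact hz2 (mem_iUnion.2 ⟨k, hz⟩)
  choose O hOo hCO hOev using h1
  obtain ⟨M, hM0, hM⟩ := h.exists_norm_le (‖p‖ + 1)
  set Kc : Set ℂ := {w | ‖w‖ ≤ M ∧ η ≤ w.im} \ ⋃ k, O k with hKc
  have hKcc : IsCompact Kc := by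
    refine Metric.isCompact_of_isClosed_isBounded ?_ ?_
    · refine IsClosed.sdiff ?_ (isOpen_iUnion hOo)
      exact (isClosed_le continuous_norm continuous_const).inter
        (isClosed_le continuous_const continuous_im)
    · exact (isBounded_iff_forall_norm_le.2 ⟨M, fun w hw => hw.1.1⟩)
  have hKcD : Kc ⊆ D := by
    rintro w ⟨⟨-, h1⟩, h2⟩
    rw [hD]
    refine ⟨hη.trans_le h1, fun hm => ?_⟩
    obtain ⟨j, hj⟩ := mem_iUnion.1 hm
    exact h2 (mem_iUnion.2 ⟨j, hCO j hj⟩)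
  have hc : IsCompact (h.inv '' Kc) :=
    hKcc.image_of_continuousOn (h.differentiableOn_inv.continuousOn.mono hKcD)
  have hpc : p ∉ h.inv '' Kc := by
    rintro ⟨w, hw, rfl⟩
    exact hp (h.inv_mem (hKcD hw)).1
  have h1 : ∀ᶠ z in 𝓝 p, z ∉ h.inv '' Kc ∧ ‖z‖ < ‖p‖ + 1 :=
    (show ∀ᶠ z in 𝓝 p, z ∈ (h.inv '' Kc)ᶜ from hc.isClosed.isOpen_compl.mem_nhds hpc).and
      (continuous_norm.continuousAt.eventually (gt_mem_nhds (by linarith)))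
  filter_upwards [h1.filter_mono nhdsWithin_le_nhds, eventually_all.2 hOev,
    self_mem_nhdsWithin] with z hz hzO hzG
  by_contra! hcon
  refine hz.1 ⟨g z, ⟨⟨hM z hzG hz.2.le, hcon⟩, fun hm => ?_⟩, h.inv_map hzG⟩
  obtain ⟨j, hj⟩ := mem_iUnion.1 hm
  exact hzO j hj

end SlitMap

lemma closure_level_inter_subset {G : Set ℂ} {f : ℂ → ℝ} (hf : ContinuousOn f G) {T : Set ℝ}
    (hT : IsClosed T) : closure {z ∈ G | f z ∈ T} ∩ G ⊆ {z ∈ G | f z ∈ T} := by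
  rintro p ⟨hp, hpG⟩
  refine ⟨hpG, ?_⟩
  have h1 : Tendsto f (𝓝[{z ∈ G | f z ∈ T}] p) (𝓝 (f p)) :=
    (hf p hpG).mono_left (nhdsWithin_mono _ (sep_subset _ _))
  have : (𝓝[{z ∈ G | f z ∈ T}] p).NeBot := mem_closure_iff_nhdsWithin_neBot.1 hp
  refine hT.mem_of_tendsto h1 ?_
  filter_upwards [self_mem_nhdsWithin] with z hz using hz.2

/-- A maximum principle for imaginary parts on unbounded domains, where finitely many exceptional
boundary values are allowed. -/
lemma im_le_of_boundary {G : Set ℂ} {f : ℂ → ℂ} (hG : IsOpen G) (hGp : IsPreconnected G)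
    (hf : DifferentiableOn ℂ f G) (hunb : ∀ R : ℝ, ∃ z ∈ G, R ≤ ‖z‖)
    (hinf : ∀ η > 0, ∃ R : ℝ, ∀ z ∈ G, R ≤ ‖z‖ → ‖f z‖ < η) {A : Set ℝ} (hA : A.Finite) {ω : ℝ}
    (hω : 0 ≤ ω) (hfr : ∀ p ∉ G, ∀ y > ω, y ∉ A → ∀ᶠ z in 𝓝[G] p, (f z).im ≠ y) :
    ∀ z ∈ G, (f z).im ≤ ω := by
  by_cases hnc : ∀ z ∈ G, ¬ ∀ᶠ w in 𝓝 z, f w = f z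
  · refine im_le_of_isCompact_level hG hf hnc hA fun y hy hyA => ?_
    refine isCompact_of_eventually_notMem (U := G) (sep_subset _ _) ?_ ?_ ?_
    · exact closure_level_inter_subset (f := fun z => (f z).im)
        (continuous_im.comp_continuousOn hf.continuousOn) (isClosed_singleton (x := y))
    · obtain ⟨R, hR⟩ := hinf y (hω.trans_lt hy)
      refine isBounded_iff_forall_norm_le.2 ⟨R, fun z hz => ?_⟩
      by_contra! hlt
      have h1 := hR z hz.1 hlt.le
      have h2 := (le_abs_self _).trans (abs_im_le_norm (f z))
      rw [hz.2] at h2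
      linarith
    · intro p _ hp
      filter_upwards [hfr p hp y hy hyA] with z hz hzS using hz hzS.2
  · push Not at hnc
    obtain ⟨z₀, hz₀, hev⟩ := hnc
    have h1 : EqOn f (fun _ => f z₀) G :=
      (hf.analyticOnNhd hG).eqOn_of_preconnected_of_eventuallyEq analyticOnNhd_const hGp hz₀ hev
    intro z hz
    refine le_of_forall_pos_lt_add fun η hη => ?_
    obtain ⟨R, hR⟩ := hinf η hη
    obtain ⟨w, hw, hwR⟩ := hunb R
    have h2 := hR w hw hwR
    rw [h1 hw] at h2
    rw [h1 hz]
    have h3 := (le_abs_self _).trans (abs_im_le_norm (f z₀))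
    linarith

lemma Set.Finite.exists_pos_le_abs_sub {A : Set ℝ} (hA : A.Finite) {y : ℝ} (hy : y ∉ A) :
    ∃ η > 0, ∀ a ∈ A, η ≤ |a - y| := by
  obtain ⟨η, hη, hball⟩ := Metric.isOpen_iff.1 hA.isClosed.isOpen_compl y hy
  refine ⟨η, hη, fun a ha => ?_⟩
  by_contra! hlt
  exact hball (a := a) (by rwa [mem_ball, Real.dist_eq]) ha

/-- A holomorphic function with small nonnegative imaginary part has small derivative. -/
lemma norm_deriv_le_of_im_mem_Icc {f : ℂ → ℂ} {z : ℂ} {r M : ℝ} (hr : 0 < r) (hM : 0 < M)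
    (hf : ∀ w ∈ closedBall z r, DifferentiableAt ℂ f w)
    (h0 : ∀ w ∈ closedBall z r, 0 ≤ (f w).im) (h1 : ∀ w ∈ closedBall z r, (f w).im ≤ M) :
    ‖deriv f z‖ ≤ Real.exp 1 * M / r := by
  set k : ℂ → ℂ := fun w => exp (-I * f w / M) with hk
  have hkn : ∀ w, ‖k w‖ = Real.exp ((f w).im / M) := by
    intro w
    rw [hk, Complex.norm_exp]
    congr 1
    rw [Complex.div_ofReal_re]
    simp
  have hkd : ∀ w ∈ closedBall z r, HasDerivAt k (k w * (-I * deriv f w / M)) w := fun w hw =>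
    (((hf w hw).hasDerivAt.const_mul (-I)).div_const (M : ℂ)).cexp
  have h2 : ‖deriv k z‖ ≤ Real.exp 1 / r := by
    refine norm_deriv_le_of_forall_mem_sphere_norm_le hr ?_ fun w hw => ?_
    · refine DifferentiableOn.diffContOnCl ?_
      rw [closure_ball z hr.ne']
      exact fun w hw => (hkd w hw).differentiableAt.differentiableWithinAt
    · rw [hkn, Real.exp_le_exp, div_le_one hM]
      exact h1 w (sphere_subset_closedBall hw)
  have hz := mem_closedBall_self (x := z) hr.le
  rw [(hkd z hz).deriv, norm_mul, hkn, norm_div, norm_mul, norm_neg, norm_I, one_mul, norm_real,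
    Real.norm_eq_abs, abs_of_pos hM] at h2
  have h3 : 1 ≤ Real.exp ((f z).im / M) := Real.one_le_exp (div_nonneg (h0 z hz) hM.le)
  have h4 : ‖deriv f z‖ / M ≤ Real.exp 1 / r := by
    refine le_trans ?_ h2
    exact le_mul_of_one_le_left (by positivity) h3
  rw [div_le_div_iff₀ hM hr] at h4
  rw [le_div_iff₀ hr]
  exact h4

namespace SlitMap

variable {U K D : Set ℂ} {g : ℂ → ℂ}

lemma exists_norm_ge (h : SlitMap U K D g) (ρ : ℝ) : ∃ z ∈ U \ K, ρ ≤ ‖z‖ := by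
  obtain ⟨R, hR, hout⟩ := h.bound
  have hpos : 0 < max R ρ := lt_max_of_lt_left hR
  have hn : ‖((max R ρ : ℝ) * I : ℂ)‖ = max R ρ := by
    rw [norm_mul, norm_I, mul_one, norm_real, Real.norm_eq_abs, abs_of_pos hpos]
  refine ⟨(max R ρ : ℝ) * I, hout _ ?_ ?_, ?_⟩
  · change 0 < ((max R ρ : ℝ) * I : ℂ).im
    rw [Complex.im_ofReal_mul, I_im, mul_one]
    exact hpos
  · rw [hn]; exact le_max_left _ _
  · rw [hn]; exact le_max_right _ _

/-- The height does not increase under a slit map. -/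
lemma im_map_le (h : SlitMap U K D g) (hK : (Complex.im '' K).Finite) :
    ∀ z ∈ U \ K, (g z).im ≤ z.im := by
  obtain ⟨H, hH, hHev⟩ := h.exists_heights
  have key := im_le_of_boundary h.isOpen_dom h.isPreconnected_dom (f := fun z => g z - z)
    (h.diff.sub differentiableOn_id) h.exists_norm_ge (fun η hη => by
      obtain ⟨R, -, -, hR⟩ := h.eventually_norm_sub_lt hη
      exact ⟨R, hR⟩) (A := image2 (fun a b => a - b) H (Complex.im '' K)) (hH.image2 _ hK)
    le_rfl (fun p hp y hy hyA => ?_)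
  · intro z hz
    have := key z hz
    simpa using this
  · by_cases hpU : p ∈ U
    · have hpK : p ∈ K := by
        by_contra hpK
        exact hp ⟨hpU, hpK⟩
      obtain ⟨η, hη, hη2⟩ := (hH.image2 (fun a b => a - b) hK).exists_pos_le_abs_sub hyA
      have h1 : ∀ᶠ z in 𝓝[U \ K] p, |z.im - p.im| < η / 2 := by
        have : Tendsto (fun z : ℂ => z.im) (𝓝[U \ K] p) (𝓝 p.im) :=
          continuous_im.continuousAt.tendsto.mono_left nhdsWithin_le_nhds
        exact this (Metric.ball_mem_nhds _ (half_pos hη))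
      filter_upwards [h1, hHev p hp (η / 2) (half_pos hη)] with z hz1 hz2 hz3
      obtain ⟨a, ha, hza⟩ := hz2
      have h2 := hη2 (a - p.im) ⟨a, ha, p.im, mem_image_of_mem _ hpK, rfl⟩
      rw [sub_im] at hz3
      rw [← hz3] at h2
      have h3 : |a - p.im - ((g z).im - z.im)| ≤ |(g z).im - a| + |z.im - p.im| := by
        have : a - p.im - ((g z).im - z.im) = -((g z).im - a) + (z.im - p.im) := by ring
        rw [this, ← abs_neg ((g z).im - a)]
        exact abs_add_le _ _
      linarith
    · filter_upwards [h.eventually_im_lt hpU hy, self_mem_nhdsWithin] with z hz hzG hz2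
      rw [sub_im] at hz2
      have := h.im_pos hzG
      linarith

lemma im_sub_map_le (h : SlitMap U K D g) {R : ℝ} (hR : 0 < R)
    (hout : ∀ z ∈ UHP, R ≤ ‖z‖ → z ∈ U \ K) {z : ℂ} (hz : z ∈ UHP) (hzR : R < ‖z‖) :
    (z - g z).im ≤ R ^ 2 * z.im / ‖z‖ ^ 2 := by
  set V : Set ℂ := UHP ∩ {z | R < ‖z‖} with hV
  have hVo : IsOpen V := isOpen_UHP.inter (isOpen_lt continuous_const continuous_norm)
  have hVG : V ⊆ U \ K := fun w hw => hout w hw.1 (le_of_lt hw.2)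
  have hV0 : ∀ w ∈ V, w ≠ 0 := by
    rintro w ⟨hw, -⟩ rfl
    simp [UHP] at hw
  set f : ℂ → ℂ := fun w => w - g w + R ^ 2 / w with hf
  have hfd : DifferentiableOn ℂ f V :=
    (differentiableOn_id.sub (h.diff.mono hVG)).add
      ((differentiableOn_const _).div differentiableOn_id hV0)
  have hfim : ∀ w, (f w).im = (w - g w).im - R ^ 2 * w.im / ‖w‖ ^ 2 := by
    intro w
    have : ((R : ℂ) ^ 2 / w).im = - (R ^ 2 * w.im / ‖w‖ ^ 2) := by
      rw [← ofReal_pow, div_eq_mul_inv, Complex.im_ofReal_mul, Complex.inv_im,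
        Complex.normSq_eq_norm_sq]
      ring
    rw [hf]
    simp only [add_im, this]
    ring
  have key := im_nonpos_of_isCompact_superlevel hVo hfd fun ε hε => ?_
  · have := key z ⟨hz, hzR⟩
    rw [hfim] at this
    linarith
  · refine isCompact_of_eventually_notMem (U := V) (sep_subset _ _) ?_ ?_ ?_
    · exact closure_level_inter_subset (f := fun z => (f z).im)
        (continuous_im.comp_continuousOn hfd.continuousOn) isClosed_Ici
    · obtain ⟨R', -, -, hR'⟩ := h.eventually_norm_sub_lt hε
      refine isBounded_iff_forall_norm_le.2 ⟨R', fun w hw => ?_⟩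
      by_contra! hlt
      have h1 := hR' w (hVG hw.1) hlt.le
      rw [norm_sub_rev] at h1
      have h2 := (le_abs_self _).trans (abs_im_le_norm (w - g w))
      have h3 := hw.2
      rw [hfim] at h3
      have h4 : 0 ≤ R ^ 2 * w.im / ‖w‖ ^ 2 := by
        have : 0 < w.im := hw.1.1
        positivity
      linarith
    · intro p hp hpV
      have hpc : 0 ≤ p.im ∧ R ≤ ‖p‖ := by
        have h1 : V ⊆ {w : ℂ | 0 ≤ w.im} ∩ {w | R ≤ ‖w‖} := fun w hw =>
          ⟨(show 0 < w.im from hw.1).le, (show R < ‖w‖ from hw.2).le⟩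
        exact closure_minimal h1 ((isClosed_le continuous_const continuous_im).inter
          (isClosed_le continuous_const continuous_norm)) hp
      have hp0 : ‖p‖ ≠ 0 := by linarith
      have hval : p.im - R ^ 2 * p.im / ‖p‖ ^ 2 = 0 := by
        rcases hpc.1.eq_or_lt with h1 | h1
        · rw [← h1]; simp
        · have h2 : ‖p‖ = R := by
            by_contra hne
            exact hpV ⟨h1, lt_of_le_of_ne hpc.2 (Ne.symm hne)⟩
          rw [h2]; field_simp; ring
      have hcont : ContinuousAt (fun w : ℂ => w.im - R ^ 2 * w.im / ‖w‖ ^ 2) p := by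
        have : ‖p‖ ^ 2 ≠ 0 := pow_ne_zero 2 hp0
        fun_prop (disch := assumption)
      have h1 : ∀ᶠ w in 𝓝 p, w.im - R ^ 2 * w.im / ‖w‖ ^ 2 < ε :=
        hcont.eventually (gt_mem_nhds (by simpa only [hval] using hε))
      filter_upwards [h1.filter_mono nhdsWithin_le_nhds, self_mem_nhdsWithin] with w hw hwV hwS
      have h2 := hwS.2
      rw [hfim, sub_im] at h2
      have h3 := h.im_map_pos (hVG hwV)
      linarith

/-- A bound for slit maps depending only on the size of the domain removed. -/
lemma norm_map_le (h : SlitMap U K D g) (hK : (Complex.im '' K).Finite) {R : ℝ} (hR : 0 < R)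
    (hout : ∀ z ∈ UHP, R ≤ ‖z‖ → z ∈ U \ K) {z : ℂ} (hz : z ∈ U \ K) (hzR : ‖z‖ ≤ 2 * R) :
    ‖g z‖ ≤ 40 * R := by
  set f : ℂ → ℂ := fun w => w - g w with hf
  have hmem : ∀ w ∈ UHP, R < ‖w‖ → w ∈ U \ K := fun w hw hwR => hout w hw hwR.le
  have hfd : ∀ w ∈ UHP, R < ‖w‖ → DifferentiableAt ℂ f w := fun w hw hwR =>
    differentiableAt_id.sub (h.diff.differentiableAt (h.isOpen_dom.mem_nhds (hmem w hw hwR)))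
  -- derivative bound
  have hder : ∀ w ∈ UHP, 2 * R ≤ ‖w‖ → ‖deriv f w‖ ≤ 36 * R ^ 2 / ‖w‖ ^ 2 := by
    intro w hw hwR
    have hw0 : 0 < w.im := hw
    have hwn : 0 < ‖w‖ := by linarith
    have himn := (le_abs_self _).trans (abs_im_le_norm w)
    have hball : ∀ v ∈ closedBall w (w.im / 4), 0 < v.im ∧ v.im ≤ 5 / 4 * w.im ∧
        3 / 4 * ‖w‖ ≤ ‖v‖ := by
      intro v hv
      rw [mem_closedBall, dist_eq_norm] at hv
      have h1 := abs_le.1 ((abs_im_le_norm (v - w)).trans hv)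
      rw [sub_im] at h1
      have h2 := norm_sub_norm_le w v
      rw [norm_sub_rev] at h2
      exact ⟨by linarith [h1.1], by linarith [h1.2], by linarith⟩
    have h1 := norm_deriv_le_of_im_mem_Icc (f := f) (z := w) (r := w.im / 4)
      (M := 3 * R ^ 2 * w.im / ‖w‖ ^ 2) (by linarith) (by positivity) ?_ ?_ ?_
    · refine h1.trans ?_
      have h2 : Real.exp 1 * (3 * R ^ 2 * w.im / ‖w‖ ^ 2) / (w.im / 4) =
          Real.exp 1 * (12 * R ^ 2 / ‖w‖ ^ 2) := by field_simp; ring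
      have h3 : Real.exp 1 ≤ 3 := by linarith [Real.exp_one_lt_d9]
      rw [h2]
      have h4 : 0 ≤ 12 * R ^ 2 / ‖w‖ ^ 2 := by positivity
      have h5 : 36 * R ^ 2 / ‖w‖ ^ 2 = 3 * (12 * R ^ 2 / ‖w‖ ^ 2) := by ring
      rw [h5]
      exact mul_le_mul_of_nonneg_right h3 h4
    · intro v hv
      obtain ⟨h1, h2, h3⟩ := hball v hv
      exact hfd v h1 (by linarith)
    · intro v hv
      obtain ⟨h1, h2, h3⟩ := hball v hv
      have := h.im_map_le hK v (hmem v h1 (by linarith))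
      rw [hf]; simp only [sub_im]; linarith
    · intro v hv
      obtain ⟨h1, h2, h3⟩ := hball v hv
      refine (h.im_sub_map_le hR hout h1 (by linarith)).trans ?_
      have hvn : 0 < ‖v‖ := by linarith
      rw [div_le_div_iff₀ (by positivity) (by positivity)]
      have h4 : (3 / 4 * ‖w‖) ^ 2 ≤ ‖v‖ ^ 2 := by gcongr
      have h5 : v.im * ‖w‖ ^ 2 ≤ 3 * w.im * ‖v‖ ^ 2 := by
        nlinarith [sq_nonneg ‖w‖, mul_nonneg hw0.le (sq_nonneg ‖w‖),
          mul_le_mul_of_nonneg_left h4 hw0.le]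
      nlinarith [sq_nonneg R, mul_le_mul_of_nonneg_left h5 (sq_nonneg R)]
  -- integrate along a ray
  have hcirc : ∀ w ∈ UHP, ‖w‖ = 2 * R → ‖f w‖ ≤ 18 * R := by
    intro w hw hwR
    have hwn : 0 < ‖w‖ := by linarith
    have hray : ∀ t : ℝ, 1 ≤ t → (t * w : ℂ) ∈ UHP ∧ ‖(t * w : ℂ)‖ = t * ‖w‖ := by
      intro t ht
      refine ⟨?_, ?_⟩
      · have : 0 < w.im := hw
        change 0 < ((t : ℂ) * w).im
        rw [Complex.im_ofReal_mul]
        positivity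
      · rw [norm_mul, norm_real, Real.norm_eq_abs, abs_of_pos (by linarith)]
    have hderF : ∀ t : ℝ, 1 ≤ t →
        HasDerivAt (fun t : ℝ => f (t * w) - f w) (deriv f (t * w) * w) t := by
      intro t ht
      obtain ⟨h1, h2⟩ := hray t ht
      have h3 : HasDerivAt f (deriv f (t * w)) (t * w) :=
        (hfd _ h1 (by rw [h2]; nlinarith)).hasDerivAt
      have h4 : HasDerivAt (fun t : ℝ => (t : ℂ) * w) w t := by
        simpa using (Complex.ofRealCLM.hasDerivAt (x := t)).mul_const w
      exact (HasDerivAt.comp_of_eq t h3 h4 rfl).sub_const _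
    have hbd : ∀ T : ℝ, 1 ≤ T → ‖f (T * w) - f w‖ ≤ 18 * R * (1 - T⁻¹) := by
      intro T hT
      refine image_norm_le_of_norm_deriv_right_le_deriv_boundary' (a := 1) (b := T)
        (f := fun t : ℝ => f (t * w) - f w) (f' := fun t => deriv f (t * w) * w)
        (B := fun t => 18 * R * (1 - t⁻¹)) (B' := fun t => 18 * R * (t ^ 2)⁻¹)
        (fun t ht => (hderF t ht.1).continuousAt.continuousWithinAt)
        (fun t ht => (hderF t ht.1).hasDerivWithinAt) (by simp) (fun t ht => ?_) (fun t ht => ?_)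
        (fun t ht => ?_) ⟨hT, le_rfl⟩
      · have : t ≠ 0 := by linarith [ht.1]
        fun_prop (disch := assumption)
      · have : t ≠ 0 := by linarith [ht.1]
        have h1 := ((hasDerivAt_inv this).const_sub 1).const_mul (18 * R)
        simpa using h1.hasDerivWithinAt
      · obtain ⟨h1, h2⟩ := hray t ht.1
        have h3 := hder _ h1 (by rw [h2]; nlinarith [ht.1])
        rw [norm_mul]
        refine (mul_le_mul_of_nonneg_right h3 (norm_nonneg w)).trans (le_of_eq ?_)
        have : t ≠ 0 := by linarith [ht.1]
        rw [h2, hwR]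
        field_simp
        ring
    refine le_of_forall_pos_lt_add fun η hη => ?_
    obtain ⟨R', hR', -, hR''⟩ := h.eventually_norm_sub_lt hη
    set T := max 1 (R' / ‖w‖) with hT
    have hT1 : 1 ≤ T := le_max_left _ _
    obtain ⟨h1, h2⟩ := hray T hT1
    have h3 : R' ≤ ‖(T * w : ℂ)‖ := by
      rw [h2, ← div_le_iff₀ hwn]
      exact le_max_right _ _
    have h4 := hR'' _ (hmem _ h1 (by rw [h2]; nlinarith)) h3
    rw [norm_sub_rev] at h4
    have h5 := hbd T hT1
    have h6 : 0 < T⁻¹ := inv_pos.2 (by linarith)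
    have h7 := norm_sub_norm_le (f w) (f (T * w))
    rw [norm_sub_rev (f w)] at h7
    have h8 : ‖f (T * w)‖ < η := h4
    nlinarith
  have hcirc' : ∀ w ∈ U \ K, ‖w‖ = 2 * R → ‖g w‖ ≤ 40 * R := by
    intro w hw hwR
    have h1 := hcirc w (h.dom_subset hw) hwR
    have h2 : g w = w - f w := by rw [hf]; ring
    rw [h2]
    refine (norm_sub_le _ _).trans ?_
    linarith
  rcases hzR.eq_or_lt with h1 | h1
  · exact hcirc' z hz h1
  · exact h.norm_le_of_norm_eq hcirc' z hz h1

end SlitMap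

lemma lintegral_sq_enorm_deriv_le {P : Set ℂ} (hP : IsOpen P) {k : ℂ → ℂ}
    (hk : DifferentiableOn ℂ k P) (hi : InjOn k P) {M : ℝ} (hM : ∀ z ∈ P, ‖k z‖ ≤ M) :
    ∫⁻ z in P, ‖deriv k z‖ₑ ^ 2 ≤ volume (closedBall (0 : ℂ) M) := by
  have h1 : ∀ z ∈ P, HasFDerivWithinAt k
      ((ContinuousLinearMap.toSpanSingleton ℂ (deriv k z)).restrictScalars ℝ) P z := fun z hz =>
    ((hk.differentiableAt (hP.mem_nhds hz)).hasDerivAt.hasFDerivAt.restrictScalars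
      ℝ).hasFDerivWithinAt
  have h2 := lintegral_abs_det_fderiv_eq_addHaar_image volume hP.measurableSet h1 hi
  have h3 : ∀ z : ℂ, ENNReal.ofReal |((ContinuousLinearMap.toSpanSingleton ℂ
      (deriv k z)).restrictScalars ℝ).det| = ‖deriv k z‖ₑ ^ 2 := by
    intro z
    have : ((ContinuousLinearMap.toSpanSingleton ℂ (deriv k z)).restrictScalars ℝ).det
        = ‖deriv k z‖ ^ 2 := by
      simp [ContinuousLinearMap.det, LinearMap.det_restrictScalars,
        Algebra.norm_complex_eq, Complex.normSq_eq_norm_sq]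
    rw [this, abs_of_nonneg (by positivity), ENNReal.ofReal_pow (norm_nonneg _), ofReal_norm]
  simp only [h3] at h2
  rw [h2]
  refine measure_mono ?_
  rintro _ ⟨z, hz, rfl⟩
  simpa using hM z hz

/-- The length-area principle. -/
lemma exists_lintegral_enorm_deriv_lt {P : Set ℂ} (hP : IsOpen P) {k : ℂ → ℂ}
    (hk : DifferentiableOn ℂ k P) (hi : InjOn k P) {M : ℝ} (hM0 : 0 ≤ M)
    (hM : ∀ z ∈ P, ‖k z‖ ≤ M) {a b ω : ℝ} (hω : 0 < ω)
    (hab : 2 * Real.pi * (Real.pi * M ^ 2) / ω ^ 2 < b - a) :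
    ∃ x ∈ Ioo a b, ∫⁻ y in Ioo (-Real.pi) Real.pi,
      P.indicator (fun z => ‖deriv k z‖ₑ) (x + y * I) < ENNReal.ofReal ω := by
  by_contra! hcon
  set u : ℂ → ENNReal := P.indicator (fun z => ‖deriv k z‖ₑ) with hu
  have hpi := Real.pi_pos
  have hum : Measurable u := (measurable_deriv k).enorm.indicator hP.measurableSet
  have hl : 0 < b - a := lt_of_le_of_lt (by positivity) hab
  have huu : ∀ z, u z ≠ ⊤ := by
    intro z
    by_cases hz : z ∈ P <;> simp [hu, hz]
  have hpt : ∀ z, ENNReal.ofReal ω * u z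
      ≤ ENNReal.ofReal Real.pi * u z ^ 2 + ENNReal.ofReal (ω ^ 2 / (4 * Real.pi)) := by
    intro z
    lift u z to NNReal using huu z with v
    rw [show (v : ENNReal) = ENNReal.ofReal (v : ℝ) by simp, ← ENNReal.ofReal_pow v.coe_nonneg,
      ← ENNReal.ofReal_mul hω.le, ← ENNReal.ofReal_mul hpi.le,
      ← ENNReal.ofReal_add (by positivity) (by positivity)]
    refine ENNReal.ofReal_le_ofReal ?_
    have : Real.pi * (v : ℝ) ^ 2 + ω ^ 2 / (4 * Real.pi) - ω * v
        = (2 * Real.pi * v - ω) ^ 2 / (4 * Real.pi) := by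
      field_simp
      ring
    have h2 : 0 ≤ (2 * Real.pi * v - ω) ^ 2 / (4 * Real.pi) := by positivity
    linarith
  set J : ℝ → ENNReal := fun x => ∫⁻ y in Ioo (-Real.pi) Real.pi, u (x + y * I) ^ 2 with hJ
  have hx : ∀ x ∈ Ioo a b, ENNReal.ofReal (ω ^ 2)
      ≤ ENNReal.ofReal Real.pi * J x + ENNReal.ofReal (ω ^ 2 / 2) := by
    intro x hx
    calc ENNReal.ofReal (ω ^ 2) = ENNReal.ofReal ω * ENNReal.ofReal ω := by
          rw [← ENNReal.ofReal_mul hω.le, sq]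
      _ ≤ ENNReal.ofReal ω * ∫⁻ y in Ioo (-Real.pi) Real.pi, u (x + y * I) := by
          gcongr; exact hcon x hx
      _ = ∫⁻ y in Ioo (-Real.pi) Real.pi, ENNReal.ofReal ω * u (x + y * I) := by
          rw [lintegral_const_mul' _ _ ENNReal.ofReal_ne_top]
      _ ≤ ∫⁻ y in Ioo (-Real.pi) Real.pi, (ENNReal.ofReal Real.pi * u (x + y * I) ^ 2
            + ENNReal.ofReal (ω ^ 2 / (4 * Real.pi))) := lintegral_mono fun y => hpt _
      _ = _ := by
          rw [lintegral_add_right _ measurable_const,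
            lintegral_const_mul' _ _ ENNReal.ofReal_ne_top, setLIntegral_const, Real.volume_Ioo,
            ← ENNReal.ofReal_mul (by positivity)]
          congr 2
          field_simp
          ring
  have hJint : ∫⁻ x in Ioo a b, J x ≤ ENNReal.ofReal (Real.pi * M ^ 2) := by
    have hm2 : Measurable fun z : ℂ => u z ^ 2 := hum.pow_const 2
    have e1 := volume_preserving_equiv_real_prod.symm.lintegral_comp hm2
    calc ∫⁻ x in Ioo a b, J x ≤ ∫⁻ x, J x := setLIntegral_le_lintegral _ _
      _ ≤ ∫⁻ x : ℝ, ∫⁻ y : ℝ, u (x + y * I) ^ 2 :=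
          lintegral_mono fun x => setLIntegral_le_lintegral _ _
      _ = ∫⁻ p : ℝ × ℝ, u (p.1 + p.2 * I) ^ 2 := by
          rw [Measure.volume_eq_prod, lintegral_prod _ (by fun_prop)]
      _ = ∫⁻ z, u z ^ 2 := by
          rw [← e1]
          refine lintegral_congr fun p => ?_
          rw [measurableEquivRealProd_symm_apply, ← mk_eq_add_mul_I]
      _ = ∫⁻ z in P, ‖deriv k z‖ₑ ^ 2 := by
          rw [← lintegral_indicator hP.measurableSet]
          refine lintegral_congr fun z => ?_
          by_cases hz : z ∈ P <;> simp [hu, hz]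
      _ ≤ volume (closedBall (0 : ℂ) M) := lintegral_sq_enorm_deriv_le hP hk hi hM
      _ = ENNReal.ofReal (Real.pi * M ^ 2) := by
          rw [Complex.volume_closedBall, mul_comm Real.pi, ENNReal.ofReal_mul (by positivity),
            ENNReal.ofReal_pow hM0]
          congr 1
          exact (ENNReal.ofReal_coe_nnreal (p := NNReal.pi)).symm
  have hfin : ENNReal.ofReal (ω ^ 2 * (b - a))
      ≤ ENNReal.ofReal (Real.pi * (Real.pi * M ^ 2) + ω ^ 2 / 2 * (b - a)) := by
    calc ENNReal.ofReal (ω ^ 2 * (b - a)) = ∫⁻ x in Ioo a b, ENNReal.ofReal (ω ^ 2) := by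
          rw [setLIntegral_const, Real.volume_Ioo, ← ENNReal.ofReal_mul (by positivity)]
      _ ≤ ∫⁻ x in Ioo a b, (ENNReal.ofReal Real.pi * J x + ENNReal.ofReal (ω ^ 2 / 2)) :=
          setLIntegral_mono' measurableSet_Ioo hx
      _ ≤ _ := by
          rw [lintegral_add_right _ measurable_const,
            lintegral_const_mul' _ _ ENNReal.ofReal_ne_top, setLIntegral_const, Real.volume_Ioo,
            ← ENNReal.ofReal_mul (by positivity), ENNReal.ofReal_add (by positivity)
            (by positivity), ENNReal.ofReal_mul hpi.le]
          gcongr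
  rw [ENNReal.ofReal_le_ofReal_iff (by positivity)] at hfin
  rw [div_lt_iff₀ (by positivity)] at hab
  nlinarith

lemma IsSimplyConnected.exists_mem_sphere_notMem {U : Set ℂ} (hUo : IsOpen U)
    (hUc : IsSimplyConnected U) {e : ℂ} (he : e ∉ U) {r : ℝ} (hr : 0 < r) :
    ∃ z, ‖z - e‖ = r ∧ z ∉ U := by
  by_contra! hcon
  obtain ⟨L, hL⟩ := exists_primitive_inv_sub hUo hUc he
  have h1 : (∮ z in C(e, r), (z - e)⁻¹) = 0 :=
    circleIntegral.integral_eq_zero_of_hasDerivWithinAt hr.le fun z hz =>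
      (hL z (hcon z (by rwa [mem_sphere, dist_eq_norm] at hz))).hasDerivWithinAt
  rw [circleIntegral.integral_sub_center_inv e hr.ne'] at h1
  simp [Real.pi_ne_zero] at h1

namespace SlitMap

variable {U K D : Set ℂ} {g : ℂ → ℂ}

/-- If a function varies little along the arcs of a circle inside the domain, and the circle meets
the complement of `U`, then the imaginary part of the map is small on the circle. -/
lemma im_le_of_arc (h : SlitMap U K D g) {γ : ℝ → ℂ} (hγ : Continuous γ) {θ₀ θ₁ ω : ℝ}
    (h0 : γ θ₀ ∈ U \ K) (h1 : γ θ₁ ∉ U) (hK : ∀ θ, γ θ ∉ K)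
    (hvar : ∀ θ ∈ uIcc θ₀ θ₁, (∀ φ ∈ uIcc θ₀ θ, γ φ ∈ U \ K) → ‖g (γ θ) - g (γ θ₀)‖ ≤ ω) :
    (g (γ θ₀)).im ≤ ω := by
  set θ : ℝ → ℝ := fun t => θ₀ + t * (θ₁ - θ₀) with hθ
  have hθc : Continuous θ := by fun_prop
  have hcl : IsClosed {t : ℝ | γ (θ t) ∉ U \ K} :=
    (h.isOpen_dom.preimage (hγ.comp hθc)).isClosed_compl
  set S : Set ℝ := Icc 0 1 ∩ {t : ℝ | γ (θ t) ∉ U \ K} with hS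
  have hSc : IsClosed S := isClosed_Icc.inter hcl
  have h1S : (1 : ℝ) ∈ S := by
    refine ⟨by simp, ?_⟩
    change γ (θ 1) ∉ U \ K
    simp only [hθ, one_mul, add_sub_cancel]
    exact fun hm => h1 hm.1
  have hSb : BddBelow S := ⟨0, fun t ht => ht.1.1⟩
  set τ := sInf S with hτ
  have hτS : τ ∈ S := hSc.csInf_mem ⟨1, h1S⟩ hSb
  have hθ0 : θ 0 = θ₀ := by simp [hθ]
  have hτ0 : 0 < τ := by
    refine lt_of_le_of_ne hτS.1.1 fun h00 => hτS.2 ?_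
    rw [← h00, hθ0]
    exact h0
  have hin : ∀ t, 0 ≤ t → t < τ → γ (θ t) ∈ U \ K := by
    intro t ht0 ht
    by_contra hcon
    exact absurd (csInf_le hSb ⟨⟨ht0, ht.le.trans hτS.1.2⟩, hcon⟩) (not_le.2 ht)
  have hτU : γ (θ τ) ∉ U := fun hm => hτS.2 ⟨hm, hK _⟩
  refine le_of_forall_pos_le_add fun η hη => ?_
  have hev : ∀ᶠ t in 𝓝[<] τ, t ∈ Ioo 0 τ := Ioo_mem_nhdsLT hτ0
  have htend : Tendsto (fun t => γ (θ t)) (𝓝[<] τ) (𝓝[U \ K] (γ (θ τ))) := by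
    refine tendsto_nhdsWithin_iff.2
      ⟨((hγ.comp hθc).tendsto τ).mono_left nhdsWithin_le_nhds, ?_⟩
    filter_upwards [hev] with t ht using hin t ht.1.le ht.2
  obtain ⟨t, ht1, ht2⟩ := ((htend.eventually (h.eventually_im_lt hτU hη)).and hev).exists
  have ht01 : t ∈ Icc (0 : ℝ) 1 := ⟨ht2.1.le, ht2.2.le.trans hτS.1.2⟩
  have hmem : ∀ φ, φ ∈ uIcc θ₀ (θ t) → ∃ s, 0 ≤ s ∧ s ≤ t ∧ θ s = φ := by
    intro φ hφ
    rw [← segment_eq_uIcc, segment_eq_image'] at hφ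
    obtain ⟨s, hs, rfl⟩ := hφ
    refine ⟨s * t, mul_nonneg hs.1 ht01.1, mul_le_of_le_one_left ht01.1 hs.2, ?_⟩
    simp only [hθ, smul_eq_mul]
    ring
  have hvt := hvar (θ t) (by
    rw [← segment_eq_uIcc, segment_eq_image']
    exact ⟨t, ht01, by simp [hθ]⟩) (fun φ hφ => by
      obtain ⟨s, hs0, hst, rfl⟩ := hmem φ hφ
      exact hin s hs0 (hst.trans_lt ht2.2))
  have h3 := neg_abs_le (g (γ (θ t)) - g (γ θ₀)).im
  have h4 := abs_im_le_norm (g (γ (θ t)) - g (γ θ₀))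
  rw [sub_im] at h3 h4
  linarith

/-- There is a circle around a boundary point along which the imaginary part of the map is
small. -/
lemma exists_radius (h : SlitMap U K D g) {e : ℂ} (he : e ∉ U) {a b ω M : ℝ} (hω : 0 < ω)
    (hM0 : 0 ≤ M) (hM : ∀ z ∈ U \ K, ‖z - e‖ < Real.exp b → ‖g z‖ ≤ M)
    (hK : ∀ z ∈ K, Real.exp b ≤ ‖z - e‖)
    (hab : 2 * Real.pi * (Real.pi * M ^ 2) / ω ^ 2 < b - a) :
    ∃ r ∈ Ioo (Real.exp a) (Real.exp b), ∀ z ∈ U \ K, ‖z - e‖ = r → (g z).im ≤ ω := by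
  set E : ℂ → ℂ := fun w => e + exp w with hE
  have hEd : Differentiable ℂ E := by fun_prop
  have hEn : ∀ w, ‖E w - e‖ = Real.exp w.re := fun w => by simp [hE, norm_exp]
  set P : Set ℂ := {w | w.re < b ∧ -Real.pi < w.im ∧ w.im < Real.pi ∧ E w ∈ U \ K} with hP
  have hPo : IsOpen P := by
    refine (isOpen_lt continuous_re continuous_const).inter ((isOpen_lt continuous_const
      continuous_im).inter ((isOpen_lt continuous_im continuous_const).inter
      (h.isOpen_dom.preimage hEd.continuous)))
  set k : ℂ → ℂ := fun w => g (E w) with hk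
  have hkd : DifferentiableOn ℂ k P := h.diff.comp hEd.differentiableOn fun w hw => hw.2.2.2
  have hki : InjOn k P := by
    intro w hw w' hw' heq
    have h1 := h.bij.injOn hw.2.2.2 hw'.2.2.2 heq
    exact exp_inj_of_neg_pi_lt_of_le_pi hw.2.1 hw.2.2.1.le hw'.2.1 hw'.2.2.1.le
      (add_left_cancel h1)
  obtain ⟨x, hx, hlt⟩ := exists_lintegral_enorm_deriv_lt hPo hkd hki hM0 (fun w hw =>
    hM _ hw.2.2.2 (by rw [hEn]; exact Real.exp_lt_exp.2 hw.1)) hω hab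
  refine ⟨Real.exp x, ⟨Real.exp_lt_exp.2 hx.1, Real.exp_lt_exp.2 hx.2⟩, ?_⟩
  set c : ℝ → ℂ := fun θ => x + θ * I with hc
  have hcd : ∀ θ, HasDerivAt c I θ := fun θ => by
    have h1 := ((hasDerivAt_id θ).ofReal_comp.mul_const I).const_add (x : ℂ)
    simpa only [ofReal_one, one_mul, id_eq] using h1
  have hcre : ∀ θ, (c θ).re = x := fun θ => by simp [hc]
  have hcim : ∀ θ, (c θ).im = θ := fun θ => by simp [hc]
  have hcc : ContDiff ℝ 1 c := by
    have : ContDiff ℝ 1 (fun θ : ℝ => (θ : ℂ)) := ofRealCLM.contDiff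
    exact contDiff_const.add (this.mul contDiff_const)
  have hEc : ContDiff ℝ 1 (fun θ : ℝ => E (c θ)) := by
    have h1 : ContDiff ℂ 1 E := contDiff_const.add contDiff_exp
    exact (h1.restrict_scalars ℝ).comp hcc
  have harc : ∀ α β, α ≤ β → -Real.pi ≤ α → β ≤ Real.pi →
      (∀ θ ∈ Icc α β, E (c θ) ∈ U \ K) → ‖g (E (c β)) - g (E (c α))‖ ≤ ω := by
    intro α β hαβ hα hβ hmem
    have h1 : ContDiffOn ℝ 1 (fun θ => g (E (c θ))) (Icc α β) :=
      ((h.diff.contDiffOn h.isOpen_dom (n := 1)).restrict_scalars ℝ).comp hEc.contDiffOn hmem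
    have h2 := enorm_sub_le_lintegral_deriv_of_contDiffOn_Icc h1 hαβ
    have h3 : ∫⁻ θ in Icc α β, ‖deriv (fun θ => g (E (c θ))) θ‖ₑ < ENNReal.ofReal ω := by
      refine lt_of_le_of_lt ?_ hlt
      rw [← setLIntegral_congr Ioo_ae_eq_Icc]
      refine le_trans (le_of_eq ?_) (lintegral_mono_set (Ioo_subset_Ioo hα hβ))
      refine setLIntegral_congr_fun measurableSet_Ioo fun θ hθ => ?_
      have hθP : c θ ∈ P := ⟨by rw [hcre]; exact hx.2, by rw [hcim]; linarith [hθ.1],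
        by rw [hcim]; linarith [hθ.2], hmem θ (Ioo_subset_Icc_self hθ)⟩
      have h4 : HasDerivAt (fun θ => g (E (c θ))) (deriv k (c θ) * I) θ :=
        (hkd.differentiableAt (hPo.mem_nhds hθP)).hasDerivAt.comp θ (hcd θ)
      change _ = P.indicator _ (c θ)
      rw [indicator_of_mem hθP, h4.deriv, enorm_mul, ← ofReal_norm I, norm_I, ENNReal.ofReal_one,
        mul_one]
    have h5 := h2.trans_lt h3
    rw [← ofReal_norm, ENNReal.ofReal_lt_ofReal_iff hω] at h5
    exact h5.le
  intro z hz hzr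
  obtain ⟨z₁, hz₁r, hz₁⟩ := h.simply.exists_mem_sphere_notMem h.isOpen he (Real.exp_pos x)
  have harg : ∀ z, ‖z - e‖ = Real.exp x → E (c (arg (z - e))) = z := by
    intro z hz
    simp only [hE, hc]
    rw [exp_add, ← ofReal_exp, ← hz, norm_mul_exp_arg_mul_I]
    ring
  have hmain := h.im_le_of_arc (γ := fun θ => E (c θ)) (θ₀ := arg (z - e)) (θ₁ := arg (z₁ - e))
    (ω := ω) hEc.continuous (by simpa only [harg z hzr] using hz)
    (by simpa only [harg z₁ hz₁r] using hz₁)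
    (fun θ hm => by
      have := hK _ hm
      rw [hEn, hcre] at this
      exact absurd (Real.exp_lt_exp.2 hx.2) (not_lt.2 this))
    (fun θ hθ hφ => by
      have hmm : θ ∈ Icc (-Real.pi) Real.pi :=
        uIcc_subset_Icc ⟨(neg_pi_lt_arg _).le, arg_le_pi _⟩ ⟨(neg_pi_lt_arg _).le, arg_le_pi _⟩ hθ
      rcases le_total (arg (z - e)) θ with hle | hle
      · rw [uIcc_of_le hle] at hφ
        exact harc _ _ hle (neg_pi_lt_arg _).le hmm.2 hφ
      · rw [uIcc_of_ge hle] at hφ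
        rw [norm_sub_rev]
        exact harc _ _ hle hmm.1 (arg_le_pi _) hφ)
  simpa only [harg z hzr] using hmain

end SlitMap

lemma closure_connectedComponentIn_inter_subset {X : Type*} [TopologicalSpace X] {S : Set X}
    {p : X} : closure (connectedComponentIn S p) ∩ S ⊆ connectedComponentIn S p := by
  rintro q ⟨hq, hqS⟩
  by_cases hp : p ∈ S
  · have h1 : IsPreconnected (insert q (connectedComponentIn S p)) :=
      isPreconnected_connectedComponentIn.subset_closure (subset_insert _ _)
        (insert_subset hq subset_closure)
    exact h1.subset_connectedComponentIn (mem_insert_of_mem _ (mem_connectedComponentIn hp))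
      (insert_subset hqS (connectedComponentIn_subset S p)) (mem_insert _ _)
  · simp [connectedComponentIn_eq_empty hp] at hq

lemma IsPreconnected.sdiff_of_subset {X : Type*} [TopologicalSpace X] {G N N' : Set X}
    (hG : IsPreconnected G) (hN : IsOpen N) (hN' : IsClosed N')
    (hc : IsPreconnected (N \ N')) (hNG : N \ N' ⊆ G) (hNN' : N' ⊆ N) :
    IsPreconnected (G \ N') := by
  have key : ∀ u v : Set X, IsOpen u → IsOpen v → G \ N' ⊆ u ∪ v → (G \ N') ∩ (u ∩ v) = ∅ →
      N \ N' ⊆ u → G \ N' ⊆ u ∨ G \ N' ⊆ v := by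
    intro u v hu hv huv hd hNu
    have hcov : G ⊆ (u ∪ N) ∪ (v \ N') := by
      intro z hz
      by_cases hzN : z ∈ N'
      · exact Or.inl (Or.inr (hNN' hzN))
      · rcases huv ⟨hz, hzN⟩ with h1 | h1
        · exact Or.inl (Or.inl h1)
        · exact Or.inr ⟨h1, hzN⟩
    have hdj : G ∩ ((u ∪ N) ∩ (v \ N')) = ∅ := by
      refine eq_empty_of_forall_notMem fun z hz => ?_
      obtain ⟨hzG, h1, h2⟩ := hz
      have hzu : z ∈ u := h1.elim id fun hzN => hNu ⟨hzN, h2.2⟩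
      exact eq_empty_iff_forall_notMem.1 hd z ⟨⟨hzG, h2.2⟩, hzu, h2.1⟩
    rcases isPreconnected_iff_subset_of_disjoint.1 hG (u ∪ N) (v \ N') (hu.union hN)
      (hv.sdiff hN') hcov hdj with h | h
    · refine Or.inl fun z hz => ?_
      rcases h hz.1 with h1 | h1
      · exact h1
      · exact hNu ⟨h1, hz.2⟩
    · exact Or.inr fun z hz => (h hz.1).1
  refine isPreconnected_iff_subset_of_disjoint.2 fun u v hu hv huv hd => ?_
  have hsub : N \ N' ⊆ G \ N' := fun z hz => ⟨hNG hz, hz.2⟩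
  rcases isPreconnected_iff_subset_of_disjoint.1 hc u v hu hv (hsub.trans huv)
    (subset_eq_empty (inter_subset_inter_left _ hsub) hd) with h | h
  · exact key u v hu hv huv hd h
  · rw [union_comm] at huv
    rw [inter_comm u v] at hd
    exact (key v u hv hu huv hd h).symm

lemma isPreconnected_reProdIm_sdiff {x₁ x₂ y ε d : ℝ} (hx : x₁ ≤ x₂) (hε : 0 ≤ ε) (hd : ε < d) :
    IsPreconnected ((Ioo (x₁ - d) (x₂ + d) ×ℂ Ioo (y - d) (y + d)) \
      (Icc (x₁ - ε) (x₂ + ε) ×ℂ Icc (y - ε) (y + ε))) := by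
  have hbox : ∀ a b c d : ℝ, IsPreconnected (Ioo a b ×ℂ Ioo c d) := fun a b c d =>
    (((_root_.convex_Ioo a b).linear_preimage reLm).inter
      ((_root_.convex_Ioo c d).linear_preimage imLm)).isPreconnected
  have hset : (Ioo (x₁ - d) (x₂ + d) ×ℂ Ioo (y - d) (y + d)) \
      (Icc (x₁ - ε) (x₂ + ε) ×ℂ Icc (y - ε) (y + ε))
      = ((Ioo (x₁ - d) (x₁ - ε) ×ℂ Ioo (y - d) (y + d)) ∪
        (Ioo (x₁ - d) (x₂ + d) ×ℂ Ioo (y + ε) (y + d))) ∪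
        ((Ioo (x₂ + ε) (x₂ + d) ×ℂ Ioo (y - d) (y + d)) ∪
        (Ioo (x₁ - d) (x₂ + d) ×ℂ Ioo (y - d) (y - ε))) := by
    ext z
    simp only [Set.mem_sdiff, mem_union, mem_reProdIm, mem_Ioo, mem_Icc]
    grind
  rw [hset]
  set m := (ε + d) / 2 with hm
  have h1 : ε < m := by linarith
  have h2 : m < d := by linarith
  refine IsPreconnected.union (⟨x₁ - m, y - m⟩ : ℂ) ?_ ?_ ?_ ?_
  · simp only [mem_union, mem_reProdIm, mem_Ioo]; grind
  · simp only [mem_union, mem_reProdIm, mem_Ioo]; grind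
  · refine IsPreconnected.union (⟨x₁ - m, y + m⟩ : ℂ) ?_ ?_ (hbox _ _ _ _) (hbox _ _ _ _)
    · simp only [mem_reProdIm, mem_Ioo]; grind
    · simp only [mem_reProdIm, mem_Ioo]; grind
  · refine IsPreconnected.union (⟨x₂ + m, y - m⟩ : ℂ) ?_ ?_ (hbox _ _ _ _) (hbox _ _ _ _)
    · simp only [mem_reProdIm, mem_Ioo]; grind
    · simp only [mem_reProdIm, mem_Ioo]; grind

/-- Small sets near a slit do not separate points from infinity. -/
lemma IsHorizontalSlit.eventually_not_isBounded {C W : Set ℂ} (hC : IsHorizontalSlit C)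
    (hW : IsOpen W) (hCW : C ⊆ W) :
    ∀ᶠ ε in 𝓝[>] (0 : ℝ), ∀ G : Set ℂ, IsPreconnected G → ¬ IsBounded G → W \ C ⊆ G →
      ∀ e ∈ C, ∀ X ⊆ closedBall e ε, ∀ p ∈ G, p ∉ W →
        p ∉ X ∧ ¬ IsBounded (connectedComponentIn (G \ X) p) := by
  obtain ⟨δ, hδ, hδW⟩ := hC.isCompact.exists_thickening_subset_open hW hCW
  obtain ⟨y, x₁, x₂, -, hx, rfl⟩ := hC
  filter_upwards [Ioo_mem_nhdsGT (half_pos hδ)] with ε hε G hG hGb hWG e he X hX p hp hpW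
  set d := δ / 2 with hd
  set N := Ioo (x₁ - d) (x₂ + d) ×ℂ Ioo (y - d) (y + d) with hN
  set N' := Icc (x₁ - ε) (x₂ + ε) ×ℂ Icc (y - ε) (y + ε) with hN'
  have hNo : IsOpen N := isOpen_Ioo.reProdIm isOpen_Ioo
  have hN'c : IsClosed N' := isClosed_Icc.reProdIm isClosed_Icc
  have hNW : N ⊆ W := by
    intro z hz
    refine hδW ?_
    obtain ⟨⟨h1, h2⟩, h3, h4⟩ := hz
    change x₁ - d < z.re at h1
    change z.re < x₂ + d at h2
    change y - d < z.im at h3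
    change z.im < y + d at h4
    rw [mem_thickening_iff]
    refine ⟨⟨max x₁ (min x₂ z.re), y⟩, ⟨rfl, le_max_left _ _, max_le hx.le (min_le_left _ _)⟩, ?_⟩
    rw [dist_eq_norm]
    refine (norm_le_abs_re_add_abs_im _).trans_lt ?_
    have e1 : |z.re - max x₁ (min x₂ z.re)| < d := by
      rw [abs_lt]
      rcases max_cases x₁ (min x₂ z.re) with h | h <;> rcases min_cases x₂ z.re with h' | h' <;>
        constructor <;> linarith [hε.1, hε.2]
    have e2 : |z.im - y| < d := by
      rw [abs_lt]
      constructor <;> linarith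
    simp only [sub_re, sub_im]
    linarith
  have hNN' : N' ⊆ N := by
    intro z hz
    obtain ⟨⟨h1, h2⟩, h3, h4⟩ := hz
    exact ⟨⟨by linarith [hε.2], by linarith [hε.2]⟩, by linarith [hε.2], by linarith [hε.2]⟩
  have hXN' : X ⊆ N' := by
    intro z hz
    have h1 := hX hz
    rw [mem_closedBall, dist_eq_norm] at h1
    have h2 := abs_le.1 ((abs_re_le_norm _).trans h1)
    have h3 := abs_le.1 ((abs_im_le_norm _).trans h1)
    simp only [sub_re, sub_im] at h2 h3
    obtain ⟨h4, h5, h6⟩ := he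
    rw [h4] at h3
    exact ⟨⟨by linarith, by linarith⟩, by linarith, by linarith⟩
  have hNG : N \ N' ⊆ G := by
    intro z hz
    refine hWG ⟨hNW hz.1, fun hzC => hz.2 ?_⟩
    obtain ⟨h4, h5, h6⟩ := hzC
    exact ⟨⟨by linarith [hε.1], by linarith [hε.1]⟩, by linarith [hε.1], by linarith [hε.1]⟩
  have hpre : IsPreconnected (G \ N') := hG.sdiff_of_subset hNo hN'c
    (isPreconnected_reProdIm_sdiff hx.le hε.1.le hε.2) hNG hNN'
  have hpN' : p ∉ N' := fun h => hpW (hNW (hNN' h))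
  refine ⟨fun h => hpN' (hXN' h), fun hb => hGb ?_⟩
  have hsub : G \ N' ⊆ connectedComponentIn (G \ X) p :=
    hpre.subset_connectedComponentIn ⟨hp, hpN'⟩ fun z hz => ⟨hz.1, fun h => hz.2 (hXN' h)⟩
  have hN'b : IsBounded N' := (Metric.isBounded_Icc _ _).reProdIm (Metric.isBounded_Icc _ _)
  refine ((hb.subset hsub).union hN'b).subset fun z hz => ?_
  by_cases h : z ∈ N'
  · exact Or.inr h
  · exact Or.inl ⟨hz, h⟩

namespace SlitMap

variable {U K D : Set ℂ} {g : ℂ → ℂ}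

lemma im_le_of_circle (h : SlitMap U K D g) {C : Set ℂ} {p e : ℂ} {r ω : ℝ}
    (hC : C ⊆ ball e r) (hp : p ∈ U \ K)
    (hsep : p ∉ C → IsBounded (connectedComponentIn ((U \ K) \ C) p))
    (hcirc : ∀ z ∈ U \ K, ‖z - e‖ = r → (g z).im ≤ ω) : (g p).im ≤ ω := by
  by_cases hpr : p ∈ sphere e r
  · exact hcirc p hp (by rwa [mem_sphere, dist_eq_norm] at hpr)
  set Q := connectedComponentIn ((U \ K) \ sphere e r) p with hQ
  have hpQ : p ∈ Q := mem_connectedComponentIn ⟨hp, hpr⟩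
  have hQsub : Q ⊆ (U \ K) \ sphere e r := connectedComponentIn_subset _ _
  have hQo : IsOpen Q := (h.isOpen_dom.sdiff isClosed_sphere).connectedComponentIn
  have hQp : IsPreconnected Q := isPreconnected_connectedComponentIn
  have hQb : IsBounded Q := by
    have hcov : Q ⊆ ball e r ∪ (closedBall e r)ᶜ := by
      intro z hz
      rcases lt_trichotomy (dist z e) r with h1 | h1 | h1
      · exact Or.inl h1
      · exact absurd h1 (hQsub hz).2
      · exact Or.inr fun h2 => absurd (mem_closedBall.1 h2) (not_le.2 h1)
    have hdisj : Q ∩ (ball e r ∩ (closedBall e r)ᶜ) = ∅ :=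
      eq_empty_of_forall_notMem fun z hz => hz.2.2 (ball_subset_closedBall hz.2.1)
    rcases isPreconnected_iff_subset_of_disjoint.1 hQp _ _ isOpen_ball
      isClosed_closedBall.isOpen_compl hcov hdisj with h1 | h1
    · exact isBounded_ball.subset h1
    · have hQC : ∀ z ∈ Q, z ∉ C := fun z hz hzC => h1 hz (ball_subset_closedBall (hC hzC))
      exact (hsep (hQC p hpQ)).subset
        (hQp.subset_connectedComponentIn hpQ fun z hz => ⟨(hQsub hz).1, hQC z hz⟩)
  obtain ⟨H, hHf, hH⟩ := h.exists_heights
  have hgQ : DifferentiableOn ℂ g Q := h.diff.mono fun z hz => (hQsub hz).1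
  refine im_le_of_isCompact_level hQo hgQ (not_eventually_const_of_injOn hQo
    (h.bij.injOn.mono fun z hz => (hQsub hz).1)) hHf (fun y hy hyH => ?_) p hpQ
  refine isCompact_of_eventually_notMem (U := Q) (sep_subset _ _)
    (closure_level_inter_subset (f := fun z => (g z).im)
      (continuous_im.comp_continuousOn hgQ.continuousOn) (isClosed_singleton (x := y)))
    (hQb.subset (sep_subset _ _)) fun q hq hqQ => ?_
  by_cases hqG : q ∈ U \ K
  · have hqs : q ∈ sphere e r := by
      by_contra hcon
      exact hqQ (closure_connectedComponentIn_inter_subset ⟨hq, hqG, hcon⟩)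
    have h1 := hcirc q hqG (by rwa [mem_sphere, dist_eq_norm] at hqs)
    have h2 : ContinuousAt (fun z => (g z).im) q :=
      continuous_im.continuousAt.comp (h.diff.continuousOn.continuousAt (h.isOpen_dom.mem_nhds hqG))
    filter_upwards [nhdsWithin_le_nhds (h2.eventually_lt_const (h1.trans_lt hy))] with z hz hzS
    exact hz.ne hzS.2
  · obtain ⟨η, hη, hηH⟩ := hHf.exists_pos_le_abs_sub hyH
    filter_upwards [nhdsWithin_mono q (fun z hz => (hQsub hz).1) (hH q hqG η hη)] with z hz hzS
    obtain ⟨a, ha, hlt⟩ := hz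
    have h1 := hηH a ha
    rw [abs_sub_comm, show y = (g z).im from hzS.2.symm] at h1
    linarith

end SlitMap

/-- Points separated from infinity by a small cross-cut are mapped close to the real axis,
uniformly in the hull. -/
lemma exists_diam_forall_im_le {N : ℕ} {Cs : Fin N → Set ℂ}
    (hslit : ∀ j, IsHorizontalSlit (Cs j)) (hdisj : Pairwise fun i j => Disjoint (Cs i) (Cs j))
    {B : Set ℂ} (hB : IsClosed B) (hBK : Disjoint B (⋃ j, Cs j)) {R : ℝ} (hR : 0 < R)
    (hRB : B ⊆ ball 0 R) (hRK : ⋃ j, Cs j ⊆ ball 0 R) {ω : ℝ} (hω : 0 < ω) :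
    ∃ ε > 0, ∀ (F D : Set ℂ) (g : ℂ → ℂ), SlitMap (UHP \ F) (⋃ j, Cs j) D g → F ⊆ B →
      ∀ (C : Set ℂ) (p : ℂ), IsCrossCut ((UHP \ F) \ ⋃ j, Cs j) C → diam C < ε → p ∈ B →
        p ∈ (UHP \ F) \ ⋃ j, Cs j →
        (p ∉ C → IsBounded (connectedComponentIn (((UHP \ F) \ ⋃ j, Cs j) \ C) p)) →
        (g p).im ≤ ω := by
  set K := ⋃ j, Cs j with hK
  have hKc : IsCompact K := isCompact_iUnion_slits hslit
  have hKU : K ⊆ UHP := iUnion_slits_subset_UHP hslit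
  have hKim : (Complex.im '' K).Finite := by
    rw [hK, image_iUnion]
    refine finite_iUnion fun j => ?_
    obtain ⟨y, xl, xr, -, -, hCj⟩ := hslit j
    refine (finite_singleton y).subset ?_
    rw [hCj]
    rintro _ ⟨z, hz, rfl⟩
    exact hz.1
  obtain ⟨δ, hδ, hδW⟩ := hKc.exists_thickening_subset_open (isOpen_UHP.sdiff hB)
    (fun z hz => ⟨hKU hz, fun hzB => hBK.notMem_of_mem_left hzB hz⟩)
  set d := min δ R with hd
  have hd0 : 0 < d := lt_min hδ hR
  have hpi := Real.pi_pos
  obtain ⟨a, ha⟩ : ∃ a, 2 * Real.pi * (Real.pi * (40 * R) ^ 2) / ω ^ 2 < Real.log d - a :=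
    ⟨Real.log d - 2 * Real.pi * (Real.pi * (40 * R) ^ 2) / ω ^ 2 - 1, by linarith⟩
  have hslits : ∀ᶠ ε in 𝓝[>] (0 : ℝ), ∀ j, ∀ G : Set ℂ, IsPreconnected G → ¬ IsBounded G →
      (UHP \ (B ∪ ⋃ i ∈ ({j}ᶜ : Set (Fin N)), Cs i)) \ Cs j ⊆ G → ∀ e ∈ Cs j,
      ∀ X ⊆ closedBall e ε, ∀ p ∈ G, p ∉ UHP \ (B ∪ ⋃ i ∈ ({j}ᶜ : Set (Fin N)), Cs i) →
        p ∉ X ∧ ¬ IsBounded (connectedComponentIn (G \ X) p) := by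
    refine eventually_all.2 fun j => (hslit j).eventually_not_isBounded ?_ ?_
    · exact isOpen_UHP.sdiff (hB.union ((toFinite _).isClosed_biUnion
        fun i _ => (hslit i).isCompact.isClosed))
    · intro z hz
      refine ⟨(hslit j).subset_UHP hz, ?_⟩
      rintro (hzB | hzi)
      · exact hBK.notMem_of_mem_left hzB (mem_iUnion.2 ⟨j, hz⟩)
      · obtain ⟨i, hi, hzi⟩ := mem_iUnion₂.1 hzi
        exact (hdisj (i := i) (j := j) hi).notMem_of_mem_left hzi hz
  obtain ⟨ε, hεs, hε0, hεm⟩ := (hslits.and (Ioo_mem_nhdsGT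
    (lt_min (Real.exp_pos a) hω))).exists
  refine ⟨ε, hε0, fun F D g h hFB C p hC hdiam hpB hp hsep => ?_⟩
  obtain ⟨c, hcc, -, hc0, -, -, rfl⟩ := hC
  set e := c 0 with he
  have heC : e ∈ c '' Icc 0 1 := ⟨0, by simp, rfl⟩
  have hCb : IsBounded (c '' Icc 0 1) := (isCompact_Icc.image_of_continuousOn hcc).isBounded
  have hCe : ∀ z ∈ c '' Icc 0 1, dist z e < ε := fun z hz =>
    (dist_le_diam_of_mem hCb hz heC).trans_lt hdiam
  have heG : e ∉ (UHP \ F) \ K := by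
    rw [h.isOpen_dom.frontier_eq] at hc0
    exact hc0.2
  by_cases heK : e ∈ K
  · exfalso
    obtain ⟨j, hj⟩ := mem_iUnion.1 heK
    have hunb : ¬ IsBounded ((UHP \ F) \ K) := by
      intro hb
      obtain ⟨M, hM⟩ := hb.exists_norm_le
      obtain ⟨z, hz, hzM⟩ := h.exists_norm_ge (M + 1)
      linarith [hM z hz]
    obtain ⟨h1, h2⟩ := hεs j _ h.isPreconnected_dom hunb (by
      rintro z ⟨⟨hzU, hz1⟩, hz2⟩
      refine ⟨⟨hzU, fun hzF => hz1 (Or.inl (hFB hzF))⟩, fun hzK => ?_⟩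
      obtain ⟨i, hi⟩ := mem_iUnion.1 hzK
      by_cases hij : i = j
      · exact hz2 (hij ▸ hi)
      · exact hz1 (Or.inr (mem_iUnion₂.2 ⟨i, hij, hi⟩))) e hj (c '' Icc 0 1)
      (fun z hz => (hCe z hz).le) p hp (fun hpW => hpW.2 (Or.inl hpB))
    exact h2 (hsep h1)
  · have heU : e ∉ UHP \ F := fun hm => heG ⟨hm, heK⟩
    by_cases heH : e ∈ UHP
    · have heB : e ∈ B := hFB (not_not.1 fun hm => heU ⟨heH, hm⟩)
      have hexp : Real.exp (Real.log d) = d := Real.exp_log hd0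
      have hen : ‖e‖ < R := by simpa using hRB heB
      obtain ⟨r, hr, hcirc⟩ := h.exists_radius heU (a := a) (b := Real.log d) (M := 40 * R) hω
        (by positivity) (fun z hz hzd => by
          rw [hexp] at hzd
          refine h.norm_map_le hKim hR (fun w hw hwR => ?_) hz ?_
          · refine ⟨⟨hw, fun hm => ?_⟩, fun hm => ?_⟩
            · have := hRB (hFB hm)
              simp at this
              linarith
            · have := hRK hm
              simp at this
              linarith
          · have h1 := norm_le_norm_add_norm_sub' z e
            have h2 : d ≤ R := min_le_right _ _
            linarith)
        (fun z hz => by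
          rw [hexp]
          by_contra! hlt
          refine (hδW (mem_thickening_iff.2 ⟨z, hz, ?_⟩ : e ∈ thickening δ K)).2 heB
          rw [dist_comm, dist_eq_norm]
          exact hlt.trans_le (min_le_left _ _)) ha
      refine h.im_le_of_circle (C := c '' Icc 0 1) (e := e) (r := r) (fun z hz => ?_) hp hsep hcirc
      exact (hCe z hz).trans ((hεm.trans_le (min_le_left _ _)).trans hr.1)
    · refine h.im_le_of_circle (C := c '' Icc 0 1) (e := e) (r := ω) (fun z hz => ?_) hp hsep
        fun z hz hzω => ?_
      · exact (hCe z hz).trans (hεm.trans_le (min_le_right _ _))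
      · have h1 := h.im_map_le hKim z hz
        have h2 := (le_abs_self _).trans (abs_im_le_norm (z - e))
        have h3 : e.im ≤ 0 := not_lt.1 heH
        rw [sub_im] at h2
        linarith

lemma im_div_sq_sub (z : ℂ) (R : ℝ) :
    (z / (z ^ 2 - R ^ 2)).im = -((normSq z + R ^ 2) * z.im / normSq (z ^ 2 - R ^ 2)) := by
  rw [div_im]
  have h1 : (z ^ 2 - (R : ℂ) ^ 2).re = z.re ^ 2 - z.im ^ 2 - R ^ 2 := by
    simp [sq]
  have h2 : (z ^ 2 - (R : ℂ) ^ 2).im = 2 * z.re * z.im := by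
    simp [sq]
    ring
  rw [h1, h2, normSq_apply z]
  ring

lemma im_div_sq_sub_of_norm_eq {z : ℂ} {R : ℝ} (hR : 0 < R) (hz : ‖z‖ = R) (him : 0 < z.im) :
    (z / (z ^ 2 - R ^ 2)).im ≤ -(1 / (2 * R)) := by
  have h0 : z.re ^ 2 + z.im ^ 2 = R ^ 2 := by
    rw [← hz, ← normSq_eq_norm_sq, normSq_apply]
    ring
  have h1 : normSq (z ^ 2 - (R : ℂ) ^ 2) = 4 * z.im ^ 2 * R ^ 2 := by
    have h1 : (z ^ 2 - (R : ℂ) ^ 2).re = z.re ^ 2 - z.im ^ 2 - R ^ 2 := by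
      simp [sq]
    have h2 : (z ^ 2 - (R : ℂ) ^ 2).im = 2 * z.re * z.im := by
      simp [sq]
      ring
    rw [normSq_apply, h1, h2, ← h0]
    ring
  have h2 : z.im ≤ R := by
    rw [← hz]
    exact (le_abs_self _).trans (abs_im_le_norm z)
  rw [im_div_sq_sub, h1, normSq_eq_norm_sq, hz, neg_le_neg_iff]
  have : (R ^ 2 + R ^ 2) * z.im / (4 * z.im ^ 2 * R ^ 2) = 1 / (2 * z.im) := by
    field_simp
    ring
  rw [this]
  gcongr

namespace SlitMap

variable {U U' K D D' : Set ℂ} {g g' : ℂ → ℂ}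

lemma eventually_im_sub_ne (h : SlitMap U K D g) (h' : SlitMap U' K D' g') (hUU : U' ⊆ U) :
    ∃ A : Set ℝ, A.Finite ∧ ∀ p ∈ K, ∀ y ∉ A, ∀ᶠ z in 𝓝[U' \ K] p, (g z - g' z).im ≠ y := by
  obtain ⟨H, hHf, hH⟩ := h.exists_heights
  obtain ⟨H', hHf', hH'⟩ := h'.exists_heights
  refine ⟨image2 (fun a b => a - b) H H', hHf.image2 _ hHf', fun p hp y hy => ?_⟩
  obtain ⟨η, hη, hηA⟩ := (hHf.image2 (fun a b => a - b) hHf').exists_pos_le_abs_sub hy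
  filter_upwards [nhdsWithin_mono p (sdiff_subset_sdiff_left hUU)
    (hH p (fun hm => hm.2 hp) (η / 2) (half_pos hη)),
    hH' p (fun hm => hm.2 hp) (η / 2) (half_pos hη)] with z hz hz' hzy
  obtain ⟨a, ha, hlt⟩ := hz
  obtain ⟨b, hb, hlt'⟩ := hz'
  have h1 := hηA _ (mem_image2_of_mem ha hb)
  rw [← hzy, sub_im] at h1
  rw [abs_lt] at hlt hlt'
  rcases le_abs.1 h1 with h2 | h2 <;> linarith

lemma exists_norm_sub_lt (h : SlitMap U K D g) (h' : SlitMap U' K D' g') (hUU : U' ⊆ U) {η : ℝ}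
    (hη : 0 < η) : ∃ R : ℝ, ∀ z ∈ U' \ K, R ≤ ‖z‖ → ‖g z - g' z‖ < η := by
  obtain ⟨R, -, -, hR⟩ := h.eventually_norm_sub_lt (half_pos hη)
  obtain ⟨R', -, -, hR'⟩ := h'.eventually_norm_sub_lt (half_pos hη)
  refine ⟨max R R', fun z hz hzR => ?_⟩
  have h1 := hR z ⟨hUU hz.1, hz.2⟩ ((le_max_left _ _).trans hzR)
  have h2 := hR' z hz ((le_max_right _ _).trans hzR)
  rw [show g z - g' z = (g z - z) - (g' z - z) by ring]
  linarith [norm_sub_le (g z - z) (g' z - z)]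

lemma im_sub_le (h : SlitMap U K D g) (h' : SlitMap U' K D' g') (hUU : U' ⊆ U) {ω : ℝ}
    (hω : 0 ≤ ω) (hU : ∀ p ∈ U \ K, p ∉ U' → (g p).im ≤ ω) :
    ∀ z ∈ U' \ K, (g z - g' z).im ≤ ω := by
  obtain ⟨A, hA, hAK⟩ := h.eventually_im_sub_ne h' hUU
  have hsub : U' \ K ⊆ U \ K := sdiff_subset_sdiff_left hUU
  refine im_le_of_boundary (f := fun z => g z - g' z) h'.isOpen_dom h'.isPreconnected_dom
    ((h.diff.mono hsub).sub h'.diff) h'.exists_norm_ge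
    (fun η hη => h.exists_norm_sub_lt h' hUU hη) hA hω fun p hp y hy hyA => ?_
  by_cases hpK : p ∈ K
  · exact hAK p hpK y hyA
  have hev : ∀ᶠ z in 𝓝[U' \ K] p, (g z).im < y := by
    by_cases hpU : p ∈ U
    · have h1 : ContinuousAt (fun z => (g z).im) p := continuous_im.continuousAt.comp
        (h.diff.continuousOn.continuousAt (h.isOpen_dom.mem_nhds ⟨hpU, hpK⟩))
      exact nhdsWithin_le_nhds (h1.eventually_lt_const
        ((hU p ⟨hpU, hpK⟩ fun hpU' => hp ⟨hpU', hpK⟩).trans_lt hy))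
    · exact nhdsWithin_mono p hsub (h.eventually_im_lt hpU (hω.trans_lt hy))
  filter_upwards [hev, self_mem_nhdsWithin] with z hz hzG hzy
  have := h'.im_map_pos hzG
  rw [sub_im] at hzy
  linarith

lemma im_sub_nonneg (h : SlitMap U K D g) (h' : SlitMap U' K D' g') (hUU : U' ⊆ U) :
    ∀ z ∈ U' \ K, 0 ≤ (g z - g' z).im := by
  obtain ⟨A, hA, hAK⟩ := h.eventually_im_sub_ne h' hUU
  have hsub : U' \ K ⊆ U \ K := sdiff_subset_sdiff_left hUU
  have key := im_le_of_boundary (f := fun z => -(g z - g' z)) (ω := 0) h'.isOpen_dom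
    h'.isPreconnected_dom ((h.diff.mono hsub).sub h'.diff).neg h'.exists_norm_ge
    (fun η hη => by simpa only [norm_neg] using h.exists_norm_sub_lt h' hUU hη)
    (hA.image Neg.neg) le_rfl fun p hp y hy hyA => ?_
  · intro z hz
    have := key z hz
    rw [neg_im] at this
    linarith
  by_cases hpK : p ∈ K
  · have hyA' : -y ∉ A := fun hm => hyA ⟨-y, hm, neg_neg y⟩
    filter_upwards [hAK p hpK (-y) hyA'] with z hz hzy
    rw [neg_im] at hzy
    exact hz (by linarith)
  filter_upwards [h'.eventually_im_lt (fun hpU => hp ⟨hpU, hpK⟩) hy, self_mem_nhdsWithin]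
    with z hz hzG hzy
  have := h.im_map_pos (hsub hzG)
  rw [neg_im, sub_im] at hzy
  linarith

lemma im_sub_le_of_norm_gt (h : SlitMap U K D g) (h' : SlitMap U' K D' g') (hUU : U' ⊆ U)
    {ω R : ℝ} (hω : 0 ≤ ω) (hU : ∀ p ∈ U \ K, p ∉ U' → (g p).im ≤ ω) (hR : 0 < R)
    (hout : ∀ z ∈ UHP, R ≤ ‖z‖ → z ∈ U' \ K) {z : ℂ} (hz : z ∈ UHP) (hzR : R < ‖z‖) :
    (g z - g' z).im ≤ -(2 * R * ω * (z / (z ^ 2 - R ^ 2)).im) := by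
  set V : Set ℂ := UHP ∩ {z | R < ‖z‖} with hV
  have hVo : IsOpen V := isOpen_UHP.inter (isOpen_lt continuous_const continuous_norm)
  have hsub : U' \ K ⊆ U \ K := sdiff_subset_sdiff_left hUU
  have hVU : V ⊆ U' \ K := fun w hw => hout w hw.1 hw.2.le
  have hne : ∀ w : ℂ, 0 < w.im → R ≤ ‖w‖ → w ^ 2 - (R : ℂ) ^ 2 ≠ 0 := by
    intro w hw hwR h0
    rcases sq_eq_sq_iff_eq_or_eq_neg.1 (sub_eq_zero.1 h0) with h1 | h1 <;>
    · rw [h1] at hw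
      simp at hw
  set f : ℂ → ℂ := fun w => g w - g' w + (2 * R * ω : ℝ) * (w / (w ^ 2 - R ^ 2)) with hf
  have him : ∀ w, (f w).im = (g w - g' w).im + 2 * R * ω * (w / (w ^ 2 - R ^ 2)).im := by
    intro w
    simp only [hf]
    rw [add_im, im_ofReal_mul]
  have hdiff : ∀ w, 0 < w.im → R ≤ ‖w‖ → DifferentiableAt ℂ f w := by
    intro w hw hwR
    have hwU := hout w hw hwR
    have h1 := h.diff.differentiableAt (h.isOpen_dom.mem_nhds (hsub hwU))
    have h2 := h'.diff.differentiableAt (h'.isOpen_dom.mem_nhds hwU)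
    have h3 : DifferentiableAt ℂ (fun w : ℂ => w / (w ^ 2 - (R : ℂ) ^ 2)) w :=
      DifferentiableAt.fun_div differentiableAt_fun_id (by fun_prop) (hne w hw hwR)
    exact (h1.sub h2).add (h3.const_mul _)
  have hfV : DifferentiableOn ℂ f V := fun w hw => (hdiff w hw.1 hw.2.le).differentiableWithinAt
  have hbar : ∀ w : ℂ, 0 < w.im → (w / (w ^ 2 - (R : ℂ) ^ 2)).im ≤ 0 := by
    intro w hw
    rw [im_div_sq_sub]
    have := normSq_nonneg w
    have h2 := normSq_nonneg (w ^ 2 - (R : ℂ) ^ 2)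
    exact neg_nonpos.2 (by positivity)
  have key := im_nonpos_of_isCompact_superlevel hVo hfV fun ε hε => ?_
  · have := key z ⟨hz, hzR⟩
    rw [him] at this
    linarith
  refine isCompact_of_eventually_notMem (U := V) (sep_subset _ _)
    (closure_level_inter_subset (f := fun z => (f z).im) (T := Ici ε)
      (continuous_im.comp_continuousOn hfV.continuousOn) isClosed_Ici) ?_ fun p hp hpV => ?_
  · obtain ⟨R₁, hR₁⟩ := h.exists_norm_sub_lt h' hUU hε
    refine isBounded_iff_forall_norm_le.2 ⟨R₁, fun w hw => ?_⟩
    by_contra! hlt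
    have h1 := hR₁ w (hVU hw.1) hlt.le
    have h2 := (le_abs_self _).trans (abs_im_le_norm (g w - g' w))
    have h3 : ε ≤ (f w).im := hw.2
    have h4 := mul_nonpos_of_nonneg_of_nonpos (by positivity : 0 ≤ 2 * R * ω) (hbar w hw.1.1)
    rw [him] at h3
    linarith
  · have hpn : R ≤ ‖p‖ := closure_minimal (fun w hw => le_of_lt (show R < ‖w‖ from hw.2))
      (isClosed_le continuous_const continuous_norm) hp
    by_cases hpim : 0 < p.im
    · have hpR : ‖p‖ = R := le_antisymm (not_lt.1 fun hlt => hpV ⟨hpim, hlt⟩) hpn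
      have h1 : (f p).im ≤ 0 := by
        have h2 := h.im_sub_le h' hUU hω hU p (hout p hpim hpn)
        have h3 := mul_le_mul_of_nonneg_left (im_div_sq_sub_of_norm_eq hR hpR hpim)
          (by positivity : 0 ≤ 2 * R * ω)
        have h4 : 2 * R * ω * -(1 / (2 * R)) = -ω := by
          field_simp
        rw [him]
        linarith
      have h2 : ContinuousAt (fun w => (f w).im) p :=
        continuous_im.continuousAt.comp (hdiff p hpim hpn).continuousAt
      filter_upwards [nhdsWithin_le_nhds (h2.eventually_lt_const (h1.trans_lt hε))] with w hw hwS
      exact absurd hw (not_lt.2 hwS.2)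
    · filter_upwards [nhdsWithin_mono p (hVU.trans hsub)
        (h.eventually_im_lt (fun hm => hpim (h.subset hm)) hε), self_mem_nhdsWithin]
        with w hw hwV hwS
      have h1 := h'.im_map_pos (hVU hwV)
      have h2 : ε ≤ (f w).im := hwS.2
      have h4 := mul_nonpos_of_nonneg_of_nonpos (by positivity : 0 ≤ 2 * R * ω) (hbar w hwV.1)
      rw [him, sub_im] at h2
      linarith

/-- The capacities of nested hulls are close if the difference set is mapped close to the real
axis. -/
lemma abs_sub_le (h : SlitMap U K D g) (h' : SlitMap U' K D' g') (hUU : U' ⊆ U)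
    {ω R : ℝ} (hω : 0 ≤ ω) (hU : ∀ p ∈ U \ K, p ∉ U' → (g p).im ≤ ω) (hR : 0 < R)
    (hout : ∀ z ∈ UHP, R ≤ ‖z‖ → z ∈ U' \ K) {l l' θ : ℝ} (hθ : θ < Real.pi / 2)
    (hl : Tendsto (fun z => z * (g z - z)) (cobounded ℂ ⊓ 𝓟 (Sector θ)) (𝓝 (l : ℂ)))
    (hl' : Tendsto (fun z => z * (g' z - z)) (cobounded ℂ ⊓ 𝓟 (Sector θ)) (𝓝 (l' : ℂ))) :
    |l - l'| ≤ 2 * R * ω := by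
  have hI : Tendsto (fun y : ℝ => (y : ℂ) * I) atTop (cobounded ℂ ⊓ 𝓟 (Sector θ)) := by
    refine tendsto_inf.2 ⟨?_, tendsto_principal.2 ?_⟩
    · rw [← tendsto_norm_atTop_iff_cobounded]
      simpa using tendsto_abs_atTop_atTop
    · filter_upwards [eventually_gt_atTop 0] with y hy
      change θ < arg (y * I) ∧ arg (y * I) < Real.pi - θ
      rw [arg_real_mul I hy, arg_I]
      constructor <;> linarith
  have h1 : Tendsto (fun y : ℝ => ((y : ℂ) * I * (g (y * I) - g' (y * I))).re) atTop
      (𝓝 (l - l')) := by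
    have h2 := (continuous_re.tendsto _).comp ((hl.sub hl').comp hI)
    rw [sub_re, ofReal_re, ofReal_re] at h2
    refine h2.congr fun y => ?_
    simp only [Function.comp_apply]
    congr 1
    ring
  refine abs_le.2 ⟨ge_of_tendsto h1 ?_, (le_of_tendsto h1 ?_).trans (by positivity : 0 ≤ 2 * R * ω)⟩
  · filter_upwards [eventually_gt_atTop R] with y hy
    have hy0 : 0 < y := hR.trans hy
    have h3 := h.im_sub_le_of_norm_gt h' hUU hω hU hR hout (z := y * I)
      (show 0 < ((y : ℂ) * I).im by simpa using hy0) (by simpa [abs_of_pos hy0] using hy)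
    have h4 : normSq (((y : ℂ) * I) ^ 2 - (R : ℂ) ^ 2) = (y ^ 2 + R ^ 2) ^ 2 := by
      have : ((y : ℂ) * I) ^ 2 - (R : ℂ) ^ 2 = ((-(y ^ 2 + R ^ 2) : ℝ) : ℂ) := by
        push_cast
        rw [mul_pow, I_sq]
        ring
      rw [this, normSq_ofReal]
      ring
    rw [im_div_sq_sub, h4, normSq_eq_norm_sq, norm_mul, norm_I, norm_real, mul_one,
      Real.norm_eq_abs, sq_abs, im_ofReal_mul, I_im, mul_one] at h3
    have h5 : (y ^ 2 + R ^ 2) * y / (y ^ 2 + R ^ 2) ^ 2 * y ≤ 1 := by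
      rw [div_mul_eq_mul_div, div_le_one (by positivity)]
      nlinarith [sq_nonneg R, sq_nonneg y, sq_nonneg (R * y), sq_nonneg (R * R)]
    have h8 : ((y : ℂ) * I * (g (y * I) - g' (y * I))).re = -((g (y * I) - g' (y * I)).im * y) := by
      rw [mul_assoc (y : ℂ) I, re_ofReal_mul, I_mul_re]
      ring
    rw [h8]
    have h6 := mul_le_mul_of_nonneg_right h3 hy0.le
    have h7 := mul_le_mul_of_nonneg_left h5 (by positivity : 0 ≤ 2 * R * ω)
    linarith
  · filter_upwards [eventually_gt_atTop R] with y hy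
    have hy0 : 0 < y := hR.trans hy
    have h3 := h.im_sub_nonneg h' hUU (y * I) (hout _
      (show 0 < ((y : ℂ) * I).im by simpa using hy0) (by simpa [abs_of_pos hy0] using hy.le))
    rw [mul_assoc (y : ℂ) I, re_ofReal_mul, I_mul_re]
    nlinarith

end SlitMap

/-- for a strictly increasing family of bounded hulls with the
local growth property, the half-plane capacity `ℓ(t)` is continuous. -/
theorem statement17 {T : ℝ} (hT : 0 < T)
    {N : ℕ} {Cs : Fin N → Set ℂ}
    (hslit : ∀ j, IsHorizontalSlit (Cs j))
    (hdisj : Pairwise fun i j => Disjoint (Cs i) (Cs j))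
    {D : Set ℂ} (hD : D = UHP \ ⋃ j, Cs j)
    {F : ℝ → Set ℂ}
    (hhull : ∀ t ∈ Set.Icc 0 T, IsHHull (F t))
    (hbdd : ∀ t ∈ Set.Icc 0 T, Bornology.IsBounded (F t))
    (hmono : ∀ s ∈ Set.Icc 0 T, ∀ t ∈ Set.Icc 0 T, s < t →
      F s ⊆ F t ∧ F s ≠ F t)
    (hFD : ∀ t ∈ Set.Icc 0 T, F t ⊆ D)
    (hFs : Disjoint (closure (F T)) (⋃ j, Cs j))
    {Dt : ℝ → Set ℂ} (hDt : ∀ t ∈ Set.Icc 0 T, IsParallelSlitHalfPlane (Dt t))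
    {g : ℝ → ℂ → ℂ}
    (hgd : ∀ t ∈ Set.Icc 0 T, DifferentiableOn ℂ (g t) (D \ F t))
    (hgb : ∀ t ∈ Set.Icc 0 T, Set.BijOn (g t) (D \ F t) (Dt t))
    (hgn : ∀ t ∈ Set.Icc 0 T,
      Tendsto (fun z => g t z - z) (cobounded ℂ ⊓ 𝓟 (D \ F t)) (𝓝 0))
    {ell : ℝ → ℝ}
    (hres : ∀ t ∈ Set.Icc 0 T, ∀ θ : ℝ, 0 < θ → θ < Real.pi / 2 →
      Tendsto (fun z => z * (g t z - z)) (cobounded ℂ ⊓ 𝓟 (Sector θ))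
        (𝓝 ((ell t : ℂ))))
    (hLG : LocalGrowth T D F) :
    ContinuousOn ell (Set.Icc 0 T) := by
  have hsets : ∀ t, D \ F t = (UHP \ F t) \ ⋃ j, Cs j := fun t => by
    rw [hD, sdiff_sdiff_comm]
  simp only [hsets] at hgd hgb hgn
  have hsubT : ∀ s ∈ Icc 0 T, ∀ t ∈ Icc 0 T, s ≤ t → F s ⊆ F t := by
    intro s hs t ht hst
    rcases hst.eq_or_lt with rfl | hlt
    · exact Subset.rfl
    · exact (hmono s hs t ht hlt).1
  have hTm : T ∈ Icc 0 T := right_mem_Icc.2 hT.le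
  have hB : ∀ t ∈ Icc 0 T, F t ⊆ closure (F T) := fun t ht =>
    (hsubT t ht T hTm ht.2).trans subset_closure
  have hKc : IsCompact (⋃ j, Cs j) := isCompact_iUnion_slits hslit
  obtain ⟨R, hR, hRb⟩ : ∃ R : ℝ, 0 < R ∧ closure (F T) ∪ ⋃ j, Cs j ⊆ ball 0 R := by
    obtain ⟨R, hR, hR'⟩ := ((hbdd T hTm).closure.union hKc.isBounded).exists_pos_norm_lt
    exact ⟨R, hR, fun z hz => mem_ball_zero_iff.2 (hR' z hz)⟩
  rw [union_subset_iff] at hRb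
  have hout : ∀ t ∈ Icc 0 T, ∀ z ∈ UHP, R ≤ ‖z‖ → z ∈ (UHP \ F t) \ ⋃ j, Cs j := by
    intro t ht z hz hzR
    exact ⟨⟨hz, fun hm => hzR.not_gt (mem_ball_zero_iff.1 (hRb.1 (hB t ht hm)))⟩,
      fun hm => hzR.not_gt (mem_ball_zero_iff.1 (hRb.2 hm))⟩
  have hmap : ∀ t ∈ Icc 0 T, SlitMap (UHP \ F t) (⋃ j, Cs j) (Dt t) (g t) := by
    intro t ht
    refine ⟨?_, sdiff_subset, (hhull t ht).2.2.2, hKc, ?_, ⟨R, hR, hout t ht⟩, hDt t ht, hgd t ht,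
      hgb t ht, hgn t ht⟩
    · have : UHP \ F t = UHP \ closure (F t) :=
        Subset.antisymm (fun z hz => ⟨hz.1, fun hm => hz.2 ((hhull t ht).2.1 ⟨hm, hz.1⟩)⟩)
          (sdiff_subset_sdiff_right subset_closure)
      rw [this]
      exact isOpen_UHP.sdiff isClosed_closure
    · refine fun z hz => ⟨iUnion_slits_subset_UHP hslit hz, fun hm => ?_⟩
      have := hFD t ht hm
      rw [hD] at this
      exact this.2 hz
  have hnear : ∀ ω > 0, ∃ δ ∈ Ioo 0 T, ∀ s ∈ Icc 0 (T - δ), ∀ t ∈ Icc s (s + δ),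
      |ell s - ell t| ≤ 2 * R * ω := by
    intro ω hω
    obtain ⟨ε, hε, hdiam⟩ := exists_diam_forall_im_le hslit hdisj isClosed_closure hFs hR hRb.1
      hRb.2 hω
    obtain ⟨δ, hδ, hsep⟩ := hLG ε hε
    refine ⟨δ, hδ, fun s hs t ht => ?_⟩
    have hs' : s ∈ Icc 0 T := ⟨hs.1, by linarith [hs.2, hδ.1]⟩
    have hsδ : s + δ ∈ Icc 0 T := ⟨by linarith [hs.1, hδ.1], by linarith [hs.2]⟩
    have ht' : t ∈ Icc 0 T := ⟨hs.1.trans ht.1, ht.2.trans hsδ.2⟩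
    obtain ⟨C, hC, hCd, hCs⟩ := hsep s hs
    rw [hsets] at hC hCs
    have hπ := Real.pi_pos
    refine (hmap s hs').abs_sub_le (hmap t ht')
      (sdiff_subset_sdiff_right (hsubT s hs' t ht' ht.1)) hω.le ?_ hR (hout t ht')
      (by linarith : Real.pi / 4 < Real.pi / 2)
      (hres s hs' _ (by linarith) (by linarith)) (hres t ht' _ (by linarith) (by linarith))
    intro p hp hpt
    have hpF : p ∈ F t := not_not.1 fun hm => hpt ⟨hp.1.1, hm⟩
    exact hdiam (F s) (Dt s) (g s) (hmap s hs') (hB s hs') C p hC hCd (hB t ht' hpF) hp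
      fun hpC => hCs p ⟨⟨hsubT t ht' _ hsδ ht.2 hpF, hp.1.2⟩, hp, hpC⟩
  rw [Metric.continuousOn_iff]
  intro b hb η hη
  obtain ⟨δ, hδ, hnear⟩ := hnear (η / (8 * R)) (by positivity)
  have hω : 2 * R * (η / (8 * R)) = η / 4 := by
    field_simp
    norm_num
  rw [hω] at hnear
  have key : ∀ s ∈ Icc 0 T, ∀ t ∈ Icc 0 T, s ≤ t → t < s + δ → |ell s - ell t| < η := by
    intro s hs t ht hst htδ
    rcases le_total s (T - δ) with h1 | h1
    · exact (hnear s ⟨hs.1, h1⟩ t ⟨hst, htδ.le⟩).trans_lt (by linarith)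
    · have hm : T - δ ∈ Icc 0 (T - δ) := right_mem_Icc.2 (by linarith [hδ.2])
      have h2 := hnear _ hm s ⟨h1, by linarith [hs.2]⟩
      have h3 := hnear _ hm t ⟨h1.trans hst, by linarith [ht.2]⟩
      rw [abs_sub_comm] at h2
      linarith [abs_sub_le (ell s) (ell (T - δ)) (ell t)]
  refine ⟨δ, hδ.1, fun a ha hab => ?_⟩
  rw [Real.dist_eq, abs_lt] at hab
  rw [Real.dist_eq]
  rcases le_total a b with h1 | h1
  · exact key a ha b hb h1 (by linarith)
  · rw [abs_sub_comm]
    exact key b hb a ha h1 (by linarith)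
end
end
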